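/- arXiv:1909.01833 — 3 statements merged into one kernel-verified Lean document; each statement's English description precedes it below -/
import Mathlib

section
/- Every positive definite quadratic form with integer coefficients of rank k ≥ 4 represents at least one square of a positive integer; that is, there exist a positive integer n and a vector x ∈ ℤ^k with f(x) = n². -/
open Finset

/-- The value of the integral quadratic form `∑_{i ≤ j} a i j * x i * x j` at `x`. -/
def qfVal {k : ℕ} (a : Fin k → Fin k → ℤ) (x : Fin k → ℤ) : ℤ :=
  ∑ i : Fin k, ∑ j : Fin k, if i ≤ j then a i j * x i * x j else 0

/-- Positive definiteness of an integral quadratic form. -/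
def qfPosDef {k : ℕ} (a : Fin k → Fin k → ℤ) : Prop :=
  ∀ x : Fin k → ℤ, x ≠ 0 → 0 < qfVal a x

/-- `qfRep a n` is the number of representations of `n` by the quadratic form. -/
noncomputable def qfRep {k : ℕ} (a : Fin k → Fin k → ℤ) (n : ℤ) : ℕ :=
  Set.ncard {x : Fin k → ℤ | qfVal a x = n}

/-- The Hessian matrix `(∂²f/∂xᵢ∂xⱼ)` of the quadratic form. -/
def qfHess {k : ℕ} (a : Fin k → Fin k → ℤ) : Matrix (Fin k) (Fin k) ℤ :=
  Matrix.of fun i j => if i = j then 2 * a i i else if i < j then a i j else a j i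

/-- The discriminant: determinant of the Hessian matrix. -/
def qfDisc {k : ℕ} (a : Fin k → Fin k → ℤ) : ℤ := (qfHess a).det

/-- The local factor `h_p(d, μ)` for a quadratic form of rank `k` with discriminant `d`. -/
def hp (k : ℕ) (d : ℤ) (p : ℕ) (μ : ℕ) : ℤ :=
  if Even k then
    ∑ t ∈ Finset.range (2 * μ + 1),
      (jacobiSym ((-1) ^ (k / 2) * d) p) ^ t * (p : ℤ) ^ (((k - 2) / 2) * t)
  else
    ((p : ℤ) ^ ((k - 2) * (μ + 1)) - 1) / ((p : ℤ) ^ (k - 2) - 1) -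
      (p : ℤ) ^ ((k - 3) / 2) * jacobiSym ((-1) ^ ((k - 1) / 2) * (d / 2)) p *
        (((p : ℤ) ^ ((k - 2) * μ) - 1) / ((p : ℤ) ^ (k - 2) - 1))

/-- Almost strong s-regularity with respect to a finite set `P` of primes. -/
def AlmostSSRegular {k : ℕ} (a : Fin k → Fin k → ℤ) (P : Finset ℕ) : Prop :=
  ∀ n₁ n₂ : ℕ, 0 < n₁ → 0 < n₂ →
    (∀ p : ℕ, p.Prime → p ∣ n₁ → p ∈ P ∨ (p : ℤ) ∣ 2 * qfDisc a) →
    IsCoprime (n₂ : ℤ) (2 * qfDisc a) → (∀ p ∈ P, ¬ p ∣ n₂) →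
    (qfRep a (((n₁ : ℤ) * (n₂ : ℤ)) ^ 2) : ℤ) =
      (qfRep a ((n₁ : ℤ) ^ 2) : ℤ) *
        ∏ p ∈ n₂.primeFactors, hp k (qfDisc a) p (n₂.factorization p)

/-- Strong s-regularity: almost strong s-regularity with respect to the empty set. -/
def StronglySSRegular {k : ℕ} (a : Fin k → Fin k → ℤ) : Prop :=
  AlmostSSRegular a ∅

/-- The minimum of positive integers `n` such that `n²` is represented. -/
noncomputable def qfMs {k : ℕ} (a : Fin k → Fin k → ℤ) : ℕ :=
  sInf {n : ℕ | 0 < n ∧ qfRep a ((n : ℤ) ^ 2) ≠ 0}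

/-- The form `a x² + b y² - z²` is isotropic over `K`. -/
def TernaryIsotropic (K : Type*) [Field K] (a b : K) : Prop :=
  ∃ x y z : K, (x ≠ 0 ∨ y ≠ 0 ∨ z ≠ 0) ∧ a * x ^ 2 + b * y ^ 2 = z ^ 2

namespace TernaryIsotropic

variable {K : Type*} [Field K] {a b : K}

theorem symm (h : TernaryIsotropic K a b) : TernaryIsotropic K b a := by
  obtain ⟨x, y, z, h0, h⟩ := h
  exact ⟨y, x, z, by tauto, by rw [add_comm, h]⟩

theorem of_mul_sq {s : K} (hs : s ≠ 0) (h : TernaryIsotropic K a (b * s ^ 2)) :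
    TernaryIsotropic K a b := by
  obtain ⟨x, y, z, h0, h⟩ := h
  exact ⟨x, s * y, z, by simpa [hs] using h0, by rw [← h]; ring⟩

theorem mul_sq {s : K} (hs : s ≠ 0) (h : TernaryIsotropic K a b) :
    TernaryIsotropic K a (b * s ^ 2) := by
  refine of_mul_sq (inv_ne_zero hs) ?_
  rwa [mul_assoc, ← mul_pow, mul_inv_cancel₀ hs, one_pow, mul_one]

theorem of_isSquare (h : IsSquare a) : TernaryIsotropic K a b := by
  obtain ⟨s, rfl⟩ := h
  exact ⟨1, 0, s, by simp, by ring⟩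

/-- If `b b'` is a norm from `K(√a)`, then `b` and `b'` may be exchanged. -/
theorem of_norm {b' t : K} (hb : b ≠ 0) (ht : t ^ 2 - a = b * b')
    (h : TernaryIsotropic K a b) : TernaryIsotropic K a b' := by
  obtain ⟨x, y, z, h0, h⟩ := h
  by_cases hy : y = 0
  · subst hy
    exact ⟨x, 0, z, by tauto, by rw [← h]; ring⟩
  · refine ⟨z + t * x, b * y, z * t + a * x, Or.inr (Or.inl (mul_ne_zero hb hy)), ?_⟩
    linear_combination (-b * y ^ 2) * ht + (t ^ 2 - a) * h

end TernaryIsotropic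

theorem exists_sq_sub_dvd_of_squarefree (a : ℤ) (n : ℕ) (hn : Squarefree n)
    (h : ∀ p : ℕ, p.Prime → p ∣ n → ∃ t : ℤ, (p : ℤ) ∣ t ^ 2 - a) :
    ∃ t : ℤ, (n : ℤ) ∣ t ^ 2 - a := by
  induction n using induction_on_primes with
  | zero => exact absurd hn not_squarefree_zero
  | one => exact ⟨0, by simp⟩
  | prime_mul p m hp ih =>
    obtain ⟨s, hs⟩ := h p hp (dvd_mul_right _ _)
    obtain ⟨t, ht⟩ := ih (hn.squarefree_of_dvd (dvd_mul_left _ _))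
      fun q hq hqm => h q hq (hqm.mul_left _)
    have hcop : IsCoprime (p : ℤ) (m : ℤ) :=
      Nat.isCoprime_iff_coprime.2 (Nat.coprime_of_squarefree_mul hn)
    obtain ⟨u, v, huv⟩ := hcop
    refine ⟨s * (v * m) + t * (u * p), ?_⟩
    push_cast
    refine IsCoprime.mul_dvd ⟨u, v, huv⟩ ?_ ?_
    · have : (s * (v * m) + t * (u * p)) ^ 2 - a =
          (s ^ 2 - a) + p * ((t * u - s * u) * (2 * s + p * (t * u - s * u))) := by
        have hv : v * (m : ℤ) = 1 - u * p := by linarith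
        rw [hv]; ring
      rw [this]; exact dvd_add hs (dvd_mul_right _ _)
    · have : (s * (v * m) + t * (u * p)) ^ 2 - a =
          (t ^ 2 - a) + m * ((s * v - t * v) * (2 * t + m * (s * v - t * v))) := by
        have hv : u * (p : ℤ) = 1 - v * m := by linarith
        rw [hv]; ring
      rw [this]; exact dvd_add ht (dvd_mul_right _ _)

section Padic

variable {p : ℕ} [Fact p.Prime]

/-- An isotropic ternary form has a primitive `p`-adic integral zero. -/
theorem TernaryIsotropic.exists_primitive {a b : ℚ_[p]} (h : TernaryIsotropic ℚ_[p] a b) :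
    ∃ x y z : ℤ_[p], (‖x‖ = 1 ∨ ‖y‖ = 1 ∨ ‖z‖ = 1) ∧
      a * (x : ℚ_[p]) ^ 2 + b * (y : ℚ_[p]) ^ 2 = (z : ℚ_[p]) ^ 2 := by
  obtain ⟨x, y, z, h0, h⟩ := h
  obtain ⟨w, hw, hxw, hyw, hzw, hw'⟩ : ∃ w : ℚ_[p], w ≠ 0 ∧ ‖x‖ ≤ ‖w‖ ∧ ‖y‖ ≤ ‖w‖ ∧ ‖z‖ ≤ ‖w‖ ∧
      (w = x ∨ w = y ∨ w = z) := by
    have hne : ∀ u v : ℚ_[p], u ≠ 0 → ‖u‖ ≤ ‖v‖ → v ≠ 0 := fun u v hu huv hv => by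
      rw [hv, norm_zero] at huv; exact hu (norm_le_zero_iff.1 huv)
    rcases le_total ‖x‖ ‖y‖ with h1 | h1 <;> rcases le_total ‖y‖ ‖z‖ with h2 | h2 <;>
      rcases le_total ‖x‖ ‖z‖ with h3 | h3
    all_goals first
      | exact ⟨z, by rcases h0 with h | h | h <;> [exact hne _ _ h h3; exact hne _ _ h h2; exact h],
          h3, h2, le_rfl, by simp⟩
      | exact ⟨y, by rcases h0 with h | h | h <;> [exact hne _ _ h h1; exact h; exact hne _ _ h h2],
          h1, le_rfl, h2, by simp⟩
      | exact ⟨x, by rcases h0 with h | h | h <;> [exact h; exact hne _ _ h h1; exact hne _ _ h h3],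
          le_rfl, h1, h3, by simp⟩
      | exact ⟨z, by rcases h0 with h | h | h <;> [exact hne _ _ h (h1.trans h2); exact hne _ _ h h2; exact h],
          h1.trans h2, h2, le_rfl, by simp⟩
      | exact ⟨x, by rcases h0 with h | h | h <;> [exact h; exact hne _ _ h h1; exact hne _ _ h (h2.trans h1)],
          le_rfl, h1, h2.trans h1, by simp⟩
  have hle : ∀ u : ℚ_[p], ‖u‖ ≤ ‖w‖ → ‖u / w‖ ≤ 1 := fun u hu => by
    rw [norm_div]; exact div_le_one_of_le₀ hu (norm_nonneg _)
  refine ⟨⟨x / w, hle x hxw⟩, ⟨y / w, hle y hyw⟩, ⟨z / w, hle z hzw⟩, ?_, ?_⟩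
  · have h1 : ‖w / w‖ = 1 := by rw [div_self hw, norm_one]
    rcases hw' with rfl | rfl | rfl
    · exact Or.inl h1
    · exact Or.inr (Or.inl h1)
    · exact Or.inr (Or.inr h1)
  · simp only
    field_simp
    exact h

/-- If `p` exactly divides `b` and `a x² + b y² = z²` is solvable `p`-adically,
then `a` is a square modulo `p`. -/
theorem TernaryIsotropic.exists_sq_sub_dvd {a b : ℤ} (hb : (p : ℤ) ∣ b) (hb2 : ¬ (p : ℤ) ^ 2 ∣ b)
    (h : TernaryIsotropic ℚ_[p] a b) : ∃ t : ℤ, (p : ℤ) ∣ t ^ 2 - a := by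
  obtain ⟨x, y, z, h0, h⟩ := h.exists_primitive
  have h' : (a : ℤ_[p]) * x ^ 2 + b * y ^ 2 = z ^ 2 := by
    apply Subtype.coe_injective; push_cast; exact h
  have hmap := congrArg (PadicInt.toZMod (p := p)) h'
  have hb0 : (b : ZMod p) = 0 := (ZMod.intCast_zmod_eq_zero_iff_dvd b p).2 hb
  simp only [map_add, map_mul, map_pow, map_intCast, hb0, zero_mul, add_zero] at hmap
  have hker : ∀ u : ℤ_[p], PadicInt.toZMod u = 0 ↔ (p : ℤ_[p]) ∣ u := fun u => by
    rw [← RingHom.mem_ker, PadicInt.ker_toZMod, PadicInt.maximalIdeal_eq_span_p,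
      Ideal.mem_span_singleton]
  have hprime : Prime (p : ℤ_[p]) := PadicInt.prime_p
  by_cases hx : PadicInt.toZMod x = 0
  · exfalso
    have hz : PadicInt.toZMod z = 0 := by
      rw [hx] at hmap; exact pow_eq_zero_iff (two_ne_zero) |>.1 (by rw [← hmap]; simp)
    obtain ⟨x', rfl⟩ := (hker x).1 hx
    obtain ⟨z', rfl⟩ := (hker z).1 hz
    obtain ⟨b', rfl⟩ := hb
    have h1 : (b' : ℤ_[p]) * y ^ 2 = p * (z' ^ 2 - a * x' ^ 2) := by
      apply mul_left_cancel₀ hprime.ne_zero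
      push_cast at h'
      linear_combination h'
    have hlt : ∀ u : ℤ_[p], (p : ℤ_[p]) ∣ u → ‖u‖ ≠ 1 := fun u hu => by
      have := (PadicInt.norm_lt_one_iff_dvd u).2 hu
      exact this.ne
    rcases hprime.dvd_or_dvd (Dvd.intro _ h1.symm) with h2 | h2
    · apply hb2
      rw [sq]
      refine mul_dvd_mul_left _ ?_
      rw [← ZMod.intCast_zmod_eq_zero_iff_dvd, ← map_intCast (PadicInt.toZMod (p := p))]
      exact (hker _).2 h2
    · have hy := hprime.dvd_of_dvd_pow h2
      rcases h0 with h0 | h0 | h0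
      · exact hlt _ (dvd_mul_right _ _) h0
      · exact hlt _ hy h0
      · exact hlt _ (dvd_mul_right _ _) h0
  · obtain ⟨t, ht⟩ := ZMod.intCast_surjective (PadicInt.toZMod z / PadicInt.toZMod x)
    refine ⟨t, ?_⟩
    rw [← ZMod.intCast_zmod_eq_zero_iff_dvd]
    push_cast
    rw [ht, div_pow, ← hmap]
    field_simp
    ring

end Padic

/-- Legendre's theorem: `a x² + b y² = z²` is solvable over `ℚ` if it is solvable
over `ℝ` and over `ℚ_p` for all odd primes `p`. -/
theorem ternaryIsotropic_rat (a b : ℤ) (ha : a ≠ 0) (hb : b ≠ 0)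
    (hp : ∀ (p : ℕ) [Fact p.Prime], p ≠ 2 → TernaryIsotropic ℚ_[p] a b)
    (hr : TernaryIsotropic ℝ a b) : TernaryIsotropic ℚ a b := by
  induction hn : a.natAbs + b.natAbs using Nat.strong_induction_on generalizing a b with
  | _ n ih =>
  wlog hab : a.natAbs ≤ b.natAbs generalizing a b
  · exact (this b a hb ha (fun p _ h2 => (hp p h2).symm) hr.symm (by omega) (by omega)).symm
  by_cases hsq : Squarefree b.natAbs
  swap
  · rw [Nat.squarefree_iff_prime_squarefree] at hsq
    push Not at hsq
    obtain ⟨q, hq, hqb⟩ := hsq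
    obtain ⟨b', rfl⟩ : ((q : ℤ) * q) ∣ b := by
      have := Int.natCast_dvd.2 hqb
      exact_mod_cast this
    have hb' : b' ≠ 0 := right_ne_zero_of_mul hb
    have hq0 : q ≠ 0 := hq.ne_zero
    have key : TernaryIsotropic ℚ a b' := by
      refine ih _ ?_ a b' ha hb' ?_ ?_ rfl
      · have h1 : 0 < b'.natAbs := Int.natAbs_pos.2 hb'
        have h2 := hq.two_le
        simp only [Int.natAbs_mul, Int.natAbs_natCast] at hn
        nlinarith [Nat.mul_le_mul h2 h2]
      · intro p _ h2
        refine TernaryIsotropic.of_mul_sq (s := (q : ℚ_[p])) (by exact_mod_cast hq0) ?_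
        convert hp p h2 using 1
        push_cast; ring
      · refine TernaryIsotropic.of_mul_sq (s := (q : ℝ)) (by exact_mod_cast hq0) ?_
        convert hr using 1
        push_cast; ring
    convert key.mul_sq (s := (q : ℚ)) (by exact_mod_cast hq0) using 1
    push_cast; ring
  have hb1 : 0 < b.natAbs := Int.natAbs_pos.2 hb
  have ha1 : 0 < a.natAbs := Int.natAbs_pos.2 ha
  rcases Nat.lt_or_ge b.natAbs 2 with hb2 | hb2
  · by_cases ha' : a = 1
    · subst ha'; exact TernaryIsotropic.of_isSquare (by simp)
    by_cases hb' : b = 1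
    · subst hb'; exact (TernaryIsotropic.of_isSquare (by simp)).symm
    exfalso
    have ha'' : a = -1 := by omega
    have hb'' : b = -1 := by omega
    subst ha'' hb''
    obtain ⟨x, y, z, h0, h⟩ := hr
    push_cast at h
    have hx : x = 0 := by nlinarith [sq_nonneg x, sq_nonneg y, sq_nonneg z]
    have hy : y = 0 := by nlinarith [sq_nonneg x, sq_nonneg y, sq_nonneg z]
    have hz : z = 0 := by nlinarith [sq_nonneg x, sq_nonneg y, sq_nonneg z]
    tauto
  obtain ⟨t, ht⟩ : ∃ t : ℤ, (b.natAbs : ℤ) ∣ t ^ 2 - a := by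
    refine exists_sq_sub_dvd_of_squarefree a _ hsq fun p hpp hpb => ?_
    have : Fact p.Prime := ⟨hpp⟩
    by_cases h2 : p = 2
    · subst h2
      refine ⟨a, ?_⟩
      rw [sq, ← mul_sub_one]
      push_cast
      exact even_iff_two_dvd.1 (Int.even_mul_pred_self a)
    · refine TernaryIsotropic.exists_sq_sub_dvd (Int.natCast_dvd.2 hpb) ?_ (hp p h2)
      intro hdvd
      have : p ^ 2 ∣ b.natAbs := by
        apply Int.natCast_dvd.1; exact_mod_cast hdvd
      exact hpp.one_lt.ne' (Nat.isUnit_iff.1 (hsq p (by rwa [sq] at this)))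
  obtain ⟨t, ht, htb⟩ : ∃ t : ℤ, b ∣ t ^ 2 - a ∧ 2 * t.natAbs ≤ b.natAbs := by
    refine ⟨t.bmod b.natAbs, ?_, ?_⟩
    · rw [← Int.natAbs_dvd]
      have h1 : (b.natAbs : ℤ) ∣ t.bmod b.natAbs - t := Int.dvd_bmod_sub_self
      have : t.bmod b.natAbs ^ 2 - a =
          (t.bmod b.natAbs - t) * (t.bmod b.natAbs + t) + (t ^ 2 - a) := by ring
      rw [this]
      exact dvd_add (h1.mul_right _) ht
    · have h1 := Int.bmod_le (x := t) hb1
      have h2 := Int.le_bmod (x := t) hb1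
      omega
  by_cases hta : t ^ 2 = a
  · exact TernaryIsotropic.of_isSquare ⟨(t : ℚ), by rw [← hta]; push_cast; ring⟩
  obtain ⟨b', hb'⟩ := ht
  have hb'0 : b' ≠ 0 := by
    rintro rfl
    exact hta (by linarith)
  have hcast : ∀ (K : Type) [Field K], (t : K) ^ 2 - a = b * b' := by
    intro K _
    exact_mod_cast congrArg (Int.cast : ℤ → K) hb'
  have hlt : b'.natAbs < b.natAbs := by
    have h1 : b.natAbs * b'.natAbs ≤ t.natAbs ^ 2 + a.natAbs := by
      rw [← Int.natAbs_mul, ← hb', ← Int.natAbs_pow]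
      omega
    by_contra hcon
    push Not at hcon
    have h2 := Nat.mul_le_mul_left b.natAbs hcon
    have h3 := Nat.mul_le_mul htb htb
    have h4 := Nat.mul_le_mul_right b.natAbs hb2
    nlinarith
  have key : TernaryIsotropic ℚ a b' := by
    refine ih _ (by omega) a b' ha hb'0 ?_ ?_ rfl
    · intro p _ h2
      exact (hp p h2).of_norm (by exact_mod_cast hb) (hcast _)
    · exact hr.of_norm (by exact_mod_cast hb) (hcast _)
  exact key.of_norm (by exact_mod_cast hb'0) ((hcast ℚ).trans (mul_comm _ _))

namespace Padic

variable {p : ℕ} [Fact p.Prime]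

theorem isSquare_of_norm_sub_one_lt {u : ℚ_[p]} (h : ‖u - 1‖ < ‖(2 : ℚ_[p])‖ ^ 2) :
    IsSquare u := by
  have h2 : ‖(2 : ℚ_[p])‖ ≤ 1 := by simpa using Padic.norm_int_le_one (p := p) 2
  have h1 : ‖u - 1‖ ≤ 1 := h.le.trans (pow_le_one₀ (norm_nonneg _) h2)
  have hu : ‖u‖ ≤ 1 := by
    have := Padic.nonarchimedean (u - 1) 1
    rw [sub_add_cancel, norm_one] at this
    exact this.trans (max_le h1 le_rfl)
  obtain ⟨u, rfl⟩ : ∃ v : ℤ_[p], (v : ℚ_[p]) = u := ⟨⟨u, hu⟩, rfl⟩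
  obtain ⟨z, hz, -⟩ := hensels_lemma (p := p) (R := ℤ_[p])
    (F := Polynomial.X ^ 2 - Polynomial.C u) (a := 1) (by
      have e1 : (Polynomial.aeval (1 : ℤ_[p])) (Polynomial.X ^ 2 - Polynomial.C u) = 1 - u := by
        simp
      have e2 : (Polynomial.aeval (1 : ℤ_[p])) (Polynomial.derivative
          (Polynomial.X ^ 2 - Polynomial.C u)) = 2 := by
        simp [one_add_one_eq_two]
      rw [e1, e2, norm_sub_rev]
      exact h)
  have hz' : z ^ 2 = u := by
    simpa [sub_eq_zero] using hz
  exact ⟨z, by rw [← hz', ← sq]; push_cast; rfl⟩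

/-- Two `p`-adic numbers that are close to each other differ by a square factor. -/
theorem exists_eq_sq_mul {u v : ℚ_[p]} (hv : v ≠ 0)
    (h : ‖u - v‖ < ‖(2 : ℚ_[p])‖ ^ 2 * ‖v‖) : ∃ s : ℚ_[p], s ≠ 0 ∧ u = v * s ^ 2 := by
  have hv' : 0 < ‖v‖ := norm_pos_iff.2 hv
  obtain ⟨s, hs⟩ : IsSquare (u / v) := by
    apply isSquare_of_norm_sub_one_lt
    rw [div_sub_one hv, norm_div]
    exact (div_lt_iff₀ hv').2 h
  have hu : u = v * s ^ 2 := by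
    rw [sq, ← hs]; field_simp
  refine ⟨s, ?_, hu⟩
  rintro rfl
  have h2 : ‖(2 : ℚ_[p])‖ ≤ 1 := by simpa using Padic.norm_int_le_one (p := p) 2
  rw [hu] at h
  simp only [ne_eq, OfNat.ofNat_ne_zero, not_false_eq_true, zero_pow, mul_zero, zero_sub,
    norm_neg] at h
  nlinarith [pow_le_one₀ (n := 2) (norm_nonneg _) h2]

theorem norm_two_of_ne_two (hp : p ≠ 2) : ‖(2 : ℚ_[p])‖ = 1 := by
  have := (Padic.norm_natCast_eq_one_iff (p := p) (n := 2)).2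
    ((Nat.coprime_primes Fact.out Nat.prime_two).2 hp)
  simpa using this

/-- For odd `p`, a ternary diagonal form with unit coefficients is isotropic. -/
theorem exists_ternary_zero_of_units (hp : p ≠ 2) {a b c : ℤ_[p]} (ha : ‖a‖ = 1) (hb : ‖b‖ = 1)
    (hc : ‖c‖ = 1) : ∃ x y z : ℚ_[p], z ≠ 0 ∧ a * x ^ 2 + b * y ^ 2 + c * z ^ 2 = 0 := by
  have hne : ∀ u : ℤ_[p], ‖u‖ = 1 → PadicInt.toZMod u ≠ 0 := fun u hu h0 => by
    rw [← RingHom.mem_ker, PadicInt.ker_toZMod, IsLocalRing.mem_maximalIdeal,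
      PadicInt.mem_nonunits] at h0
    exact h0.ne hu
  obtain ⟨x, y, hxy⟩ := FiniteField.exists_root_sum_quadratic (R := ZMod p)
    (f := Polynomial.C (PadicInt.toZMod a) * Polynomial.X ^ 2)
    (g := Polynomial.C (PadicInt.toZMod b) * Polynomial.X ^ 2 + Polynomial.C (PadicInt.toZMod c))
    (by rw [Polynomial.degree_C_mul_X_pow _ (hne a ha)]; rfl)
    (by
      rw [Polynomial.degree_add_C]
      · rw [Polynomial.degree_C_mul_X_pow _ (hne b hb)]; rfl
      · rw [Polynomial.degree_C_mul_X_pow _ (hne b hb)]; exact two_pos)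
    (by rw [ZMod.card]; exact (Fact.out : p.Prime).eq_two_or_odd.resolve_left hp)
  obtain ⟨X, rfl⟩ := ZMod.intCast_surjective x
  obtain ⟨Y, rfl⟩ := ZMod.intCast_surjective y
  have hlt : ‖-(a * (X : ℤ_[p]) ^ 2 + b * (Y : ℤ_[p]) ^ 2) - c‖ < 1 := by
    rw [← PadicInt.mem_nonunits, ← IsLocalRing.mem_maximalIdeal, ← PadicInt.ker_toZMod,
      RingHom.mem_ker]
    simp only [Polynomial.eval_mul, Polynomial.eval_C, Polynomial.eval_pow, Polynomial.eval_X,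
      Polynomial.eval_add] at hxy
    simp only [map_sub, map_neg, map_add, map_mul, map_pow, map_intCast]
    linear_combination -hxy
  have hc0 : (c : ℚ_[p]) ≠ 0 := by
    intro h
    rw [PadicInt.norm_def, h, norm_zero] at hc
    exact zero_ne_one hc
  obtain ⟨s, hs0, hs⟩ := exists_eq_sq_mul (u := ((-(a * (X : ℤ_[p]) ^ 2 + b * (Y : ℤ_[p]) ^ 2) :
    ℤ_[p]) : ℚ_[p])) hc0 (by
      rw [PadicInt.norm_def] at hc hlt
      rw [norm_two_of_ne_two hp, hc]
      push_cast at hlt ⊢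
      simpa using hlt)
  refine ⟨X, Y, s, hs0, ?_⟩
  push_cast at hs
  linear_combination -hs

end Padic

theorem PadicInt.exists_odd_int_add_eight_mul {u : ℤ_[2]} (hu : ‖u‖ = 1) :
    ∃ (n : ℤ) (r : ℤ_[2]), n % 2 = 1 ∧ u = n + 8 * r := by
  obtain ⟨r, hr⟩ := Ideal.mem_span_singleton.1 (PadicInt.appr_spec 3 u)
  refine ⟨u.appr 3, r, ?_, ?_⟩
  · by_contra hcon
    have h2 : (2 : ℤ_[2]) ∣ u := by
      obtain ⟨m, hm⟩ : (2 : ℤ) ∣ u.appr 3 := by omega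
      have hm' : ((u.appr 3 : ℕ) : ℤ_[2]) = 2 * m := by exact_mod_cast congrArg (Int.cast : ℤ → ℤ_[2]) hm
      refine ⟨m + 4 * r, ?_⟩
      push_cast at hr
      linear_combination hr + hm'
    have := (PadicInt.norm_lt_one_iff_dvd u).2 (by exact_mod_cast h2)
    exact this.ne hu
  · push_cast at hr ⊢
    linear_combination hr

/-- A `2`-adic diagonal form which vanishes modulo `8` at a vector whose first coordinate is `1`
and whose first coefficient is a unit is isotropic. -/
theorem Padic.exists_sq_of_eight_dvd {u v : ℤ_[2]} (hu : ‖u‖ = 1) (h : 8 ∣ u + v) :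
    ∃ s : ℚ_[2], s ≠ 0 ∧ u * s ^ 2 + v = 0 := by
  have hu0 : (u : ℚ_[2]) ≠ 0 := by
    intro h
    rw [PadicInt.norm_def, h, norm_zero] at hu
    exact zero_ne_one hu
  have h2 : ‖(2 : ℚ_[2])‖ = 2⁻¹ := by simpa using Padic.norm_p (p := 2)
  obtain ⟨r, hr⟩ := h
  have hr' : (u : ℚ_[2]) + v = 2 ^ 3 * r := by
    have := congrArg (Subtype.val) hr
    have h8 : ((8 : ℤ_[2]) : ℚ_[2]) = 8 := rfl
    push_cast [h8] at this
    rw [this]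
    norm_num
  obtain ⟨s, hs0, hs⟩ := exists_eq_sq_mul (u := -(v : ℚ_[2])) hu0 (by
    rw [PadicInt.norm_def] at hu
    rw [hu, ← norm_neg]
    rw [show -(-(v : ℚ_[2]) - u) = u + v by ring, hr', norm_mul, norm_pow, h2]
    have := PadicInt.norm_le_one r
    rw [PadicInt.norm_def] at this
    linarith)
  exact ⟨s, hs0, by linear_combination -hs⟩

theorem Padic.exists_quaternary_zero_two {u₁ u₂ u₃ u₄ : ℤ_[2]} (h₁ : ‖u₁‖ = 1) (h₂ : ‖u₂‖ = 1)
    (h₃ : ‖u₃‖ = 1) (h₄ : ‖u₄‖ = 1) : ∃ x y z w : ℚ_[2], x ≠ 0 ∧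
      u₁ * x ^ 2 + u₂ * y ^ 2 + u₃ * z ^ 2 + 2 * u₄ * w ^ 2 = 0 := by
  obtain ⟨n₁, r₁, ho₁, rfl⟩ := PadicInt.exists_odd_int_add_eight_mul h₁
  obtain ⟨n₂, r₂, ho₂, rfl⟩ := PadicInt.exists_odd_int_add_eight_mul h₂
  obtain ⟨n₃, r₃, ho₃, rfl⟩ := PadicInt.exists_odd_int_add_eight_mul h₃
  obtain ⟨n₄, r₄, ho₄, rfl⟩ := PadicInt.exists_odd_int_add_eight_mul h₄
  obtain ⟨y, z, w, hd⟩ : ∃ y z w : ℤ, 8 ∣ n₁ + n₂ * y ^ 2 + n₃ * z ^ 2 + 2 * n₄ * w ^ 2 := by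
    by_cases hA : 8 ∣ n₁ + n₂
    · exact ⟨1, 0, 0, by simpa using hA⟩
    by_cases hB : 4 ∣ n₁ + n₂
    · exact ⟨1, 2, 0, by omega⟩
    by_cases hC : 8 ∣ n₁ + n₃
    · exact ⟨0, 1, 0, by simpa using hC⟩
    by_cases hD : 4 ∣ n₁ + n₃
    · exact ⟨2, 1, 0, by omega⟩
    by_cases hE : 8 ∣ n₁ + n₂ + 2 * n₄
    · exact ⟨1, 0, 1, by omega⟩
    · exact ⟨1, 2, 1, by omega⟩
  obtain ⟨m, hm⟩ := hd
  obtain ⟨s, hs0, hs⟩ := Padic.exists_sq_of_eight_dvd h₁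
    (v := (n₂ + 8 * r₂) * (y : ℤ_[2]) ^ 2 + (n₃ + 8 * r₃) * (z : ℤ_[2]) ^ 2 +
      2 * (n₄ + 8 * r₄) * (w : ℤ_[2]) ^ 2) (by
    refine ⟨m + r₁ + r₂ * y ^ 2 + r₃ * z ^ 2 + 2 * r₄ * w ^ 2, ?_⟩
    have := congrArg (Int.cast : ℤ → ℤ_[2]) hm
    push_cast at this
    linear_combination this)
  refine ⟨s, y, z, w, hs0, ?_⟩
  have h2 : ((2 : ℤ_[2]) : ℚ_[2]) = 2 := rfl
  have h8 : ((8 : ℤ_[2]) : ℚ_[2]) = 8 := rfl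
  push_cast [h2, h8] at hs ⊢
  linear_combination hs

theorem Padic.exists_quinary_zero_two {u₁ u₂ u₃ u₄ u₅ : ℤ_[2]} (h₁ : ‖u₁‖ = 1) (h₂ : ‖u₂‖ = 1)
    (h₃ : ‖u₃‖ = 1) (h₄ : ‖u₄‖ = 1) (h₅ : ‖u₅‖ = 1) : ∃ x y z w v : ℚ_[2], x ≠ 0 ∧
      u₁ * x ^ 2 + u₂ * y ^ 2 + u₃ * z ^ 2 + u₄ * w ^ 2 + u₅ * v ^ 2 = 0 := by
  obtain ⟨n₁, r₁, ho₁, rfl⟩ := PadicInt.exists_odd_int_add_eight_mul h₁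
  obtain ⟨n₂, r₂, ho₂, rfl⟩ := PadicInt.exists_odd_int_add_eight_mul h₂
  obtain ⟨n₃, r₃, ho₃, rfl⟩ := PadicInt.exists_odd_int_add_eight_mul h₃
  obtain ⟨n₄, r₄, ho₄, rfl⟩ := PadicInt.exists_odd_int_add_eight_mul h₄
  obtain ⟨n₅, r₅, ho₅, rfl⟩ := PadicInt.exists_odd_int_add_eight_mul h₅
  obtain ⟨y, z, w, v, hd⟩ : ∃ y z w v : ℤ,
      8 ∣ n₁ + n₂ * y ^ 2 + n₃ * z ^ 2 + n₄ * w ^ 2 + n₅ * v ^ 2 := by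
    by_cases hA : 8 ∣ n₁ + n₂
    · exact ⟨1, 0, 0, 0, by simpa using hA⟩
    by_cases hB : 4 ∣ n₁ + n₂
    · exact ⟨1, 2, 0, 0, by omega⟩
    by_cases hC : 8 ∣ n₁ + n₃
    · exact ⟨0, 1, 0, 0, by simpa using hC⟩
    by_cases hD : 4 ∣ n₁ + n₃
    · exact ⟨2, 1, 0, 0, by omega⟩
    by_cases hE : 8 ∣ n₁ + n₄
    · exact ⟨0, 0, 1, 0, by simpa using hE⟩
    by_cases hF : 4 ∣ n₁ + n₄
    · exact ⟨2, 0, 1, 0, by omega⟩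
    by_cases hG : 8 ∣ n₁ + n₂ + n₃ + n₄
    · exact ⟨1, 1, 1, 0, by omega⟩
    · exact ⟨1, 1, 1, 2, by omega⟩
  obtain ⟨m, hm⟩ := hd
  obtain ⟨s, hs0, hs⟩ := Padic.exists_sq_of_eight_dvd h₁
    (v := (n₂ + 8 * r₂) * (y : ℤ_[2]) ^ 2 + (n₃ + 8 * r₃) * (z : ℤ_[2]) ^ 2 +
      (n₄ + 8 * r₄) * (w : ℤ_[2]) ^ 2 + (n₅ + 8 * r₅) * (v : ℤ_[2]) ^ 2) (by
    refine ⟨m + r₁ + r₂ * y ^ 2 + r₃ * z ^ 2 + r₄ * w ^ 2 + r₅ * v ^ 2, ?_⟩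
    have := congrArg (Int.cast : ℤ → ℤ_[2]) hm
    push_cast at this
    linear_combination this)
  refine ⟨s, y, z, w, v, hs0, ?_⟩
  have h2 : ((2 : ℤ_[2]) : ℚ_[2]) = 2 := rfl
  have h8 : ((8 : ℤ_[2]) : ℚ_[2]) = 8 := rfl
  push_cast [h2, h8] at hs ⊢
  linear_combination hs

section Quinary

variable {p : ℕ} [Fact p.Prime]

theorem Padic.exists_eq_sq_mul_unit {t : ℚ_[p]} (ht : t ≠ 0) :
    ∃ (e : Bool) (s : ℚ_[p]) (u : ℤ_[p]), s ≠ 0 ∧ ‖u‖ = 1 ∧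
      t = s ^ 2 * (u * (if e then (p : ℚ_[p]) else 1)) := by
  have hp0 : (p : ℚ_[p]) ≠ 0 := by exact_mod_cast (Fact.out : p.Prime).ne_zero
  have hn : ‖t / (p : ℚ_[p]) ^ t.valuation‖ = 1 := by
    rw [norm_div, Padic.norm_p_zpow, Padic.norm_eq_zpow_neg_valuation ht, div_self]
    exact zpow_ne_zero _ (by exact_mod_cast (Fact.out : p.Prime).ne_zero)
  rcases Int.even_or_odd' t.valuation with ⟨k, hk | hk⟩
  · refine ⟨false, (p : ℚ_[p]) ^ k, ⟨t / (p : ℚ_[p]) ^ t.valuation, hn.le⟩,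
      zpow_ne_zero _ hp0, hn, ?_⟩
    have : ((p : ℚ_[p]) ^ k) ^ 2 = (p : ℚ_[p]) ^ t.valuation := by
      rw [hk, ← zpow_natCast, ← zpow_mul]; congr 1; push_cast; ring
    rw [this]
    simp only [Bool.false_eq_true, if_false, mul_one]
    rw [mul_div_cancel₀ _ (zpow_ne_zero _ hp0)]
  · refine ⟨true, (p : ℚ_[p]) ^ k, ⟨t / (p : ℚ_[p]) ^ t.valuation, hn.le⟩,
      zpow_ne_zero _ hp0, hn, ?_⟩
    have : ((p : ℚ_[p]) ^ k) ^ 2 * p = (p : ℚ_[p]) ^ t.valuation := by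
      rw [hk, ← zpow_natCast, ← zpow_mul, zpow_add_one₀ hp0]; congr 2; push_cast; ring
    simp only [if_true]
    rw [mul_comm _ (p : ℚ_[p]), ← mul_assoc, this, mul_div_cancel₀ _ (zpow_ne_zero _ hp0)]

/-- Up to a common factor and square factors, at least three coefficients of a quinary
diagonal form are units and the others are units or `p` times units. -/
theorem Padic.exists_quinary_normalization (t : Fin 5 → ℚ_[p]) (ht : ∀ i, t i ≠ 0) :
    ∃ (μ : ℚ_[p]) (s : Fin 5 → ℚ_[p]) (e : Fin 5 → Bool) (u : Fin 5 → ℤ_[p]),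
      μ ≠ 0 ∧ (∀ i, s i ≠ 0) ∧ (∀ i, ‖u i‖ = 1) ∧
      (∀ i, t i = μ * s i ^ 2 * (u i * (if e i then (p : ℚ_[p]) else 1))) ∧
      ∃ i j k, i ≠ j ∧ i ≠ k ∧ j ≠ k ∧ e i = false ∧ e j = false ∧ e k = false := by
  have hp0 : (p : ℚ_[p]) ≠ 0 := by exact_mod_cast (Fact.out : p.Prime).ne_zero
  choose e s u hs hu h using fun i => Padic.exists_eq_sq_mul_unit (ht i)
  obtain ⟨b, hb⟩ := Fintype.exists_lt_card_fiber_of_mul_lt_card (f := e) (n := 2) (by simp)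
  obtain ⟨i, j, k, hi, hj, hk, hij, hik, hjk⟩ := Finset.two_lt_card_iff.1 hb
  simp only [mem_filter, mem_univ, true_and] at hi hj hk
  cases b with
  | false => exact ⟨1, s, e, u, one_ne_zero, hs, hu, by simpa using h, i, j, k, hij, hik, hjk, hi, hj, hk⟩
  | true =>
    refine ⟨(p : ℚ_[p]), fun l => if e l then s l else s l / p, fun l => !e l, u, hp0, ?_, hu, ?_,
      i, j, k, hij, hik, hjk, by simp [hi], by simp [hj], by simp [hk]⟩
    · intro l
      dsimp only
      split_ifs
      · exact hs l
      · exact div_ne_zero (hs l) hp0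
    · intro l
      rw [h l]
      cases hel : e l
      · simp only [hel, Bool.false_eq_true, if_false, Bool.not_false, if_true]; field_simp
      · simp only [hel, Bool.false_eq_true, if_false, Bool.not_true, if_true]; ring

theorem Finset.sum_mul_update_sq {K : Type*} [Field K] {i j k l : Fin 5} (hij : i ≠ j) (hik : i ≠ k)
    (hjk : j ≠ k) (hil : i ≠ l) (hjl : j ≠ l) (hkl : k ≠ l) (w : Fin 5 → K) (X Y Z W : K) :
    ∑ m, w m * (Pi.single i X + Pi.single j Y + Pi.single k Z + Pi.single l W : Fin 5 → K) m ^ 2 =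
      w i * X ^ 2 + w j * Y ^ 2 + w k * Z ^ 2 + w l * W ^ 2 := by
  have : ∀ m, w m * (Pi.single i X + Pi.single j Y + Pi.single k Z + Pi.single l W : Fin 5 → K) m ^ 2
      = (Pi.single i (w i * X ^ 2) + Pi.single j (w j * Y ^ 2) + Pi.single k (w k * Z ^ 2) +
        Pi.single l (w l * W ^ 2) : Fin 5 → K) m := by
    intro m
    simp only [Pi.add_apply, Pi.single_apply]
    by_cases h1 : m = i
    · subst h1; simp [hij, hik, hil]
    by_cases h2 : m = j
    · subst h2; simp [h1, hjk, hjl]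
    by_cases h3 : m = k
    · subst h3; simp [h1, h2, hkl]
    by_cases h4 : m = l
    · subst h4; simp [h1, h2, h3]
    simp [h1, h2, h3, h4]
  rw [sum_congr rfl fun m _ => this m]
  simp only [Pi.add_apply, sum_add_distrib, sum_pi_single', mem_univ, if_true]

/-- Every quinary diagonal form over `ℚ_p` is isotropic. -/
theorem Padic.exists_quinary_zero (t : Fin 5 → ℚ_[p]) (ht : ∀ i, t i ≠ 0) :
    ∃ x : Fin 5 → ℚ_[p], x ≠ 0 ∧ ∑ i, t i * x i ^ 2 = 0 := by
  obtain ⟨μ, s, e, u, hμ, hs, hu, h, i, j, k, hij, hik, hjk, hi, hj, hk⟩ :=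
    Padic.exists_quinary_normalization t ht
  suffices H : ∃ x : Fin 5 → ℚ_[p], x ≠ 0 ∧
      ∑ i, (u i * (if e i then (p : ℚ_[p]) else 1)) * x i ^ 2 = 0 by
    obtain ⟨x, hx, hx0⟩ := H
    refine ⟨fun l => x l / s l, ?_, ?_⟩
    · intro h0
      apply hx
      funext l
      have := congrFun h0 l
      simpa [hs l] using this
    · have : ∀ l, t l * (x l / s l) ^ 2 =
          μ * ((u l * (if e l then (p : ℚ_[p]) else 1)) * x l ^ 2) := by
        intro l
        rw [h l]
        have := hs l
        field_simp
      simp only [this, ← mul_sum, hx0, mul_zero]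
  obtain ⟨l, hil, hjl, hkl⟩ : ∃ l, i ≠ l ∧ j ≠ l ∧ k ≠ l := by
    clear hi hj hk
    revert i j k; decide
  by_cases hp : p = 2
  · subst hp
    by_cases hall : ∀ l, e l = false
    · obtain ⟨x, y, z, w, v, hx, hsum⟩ :=
        Padic.exists_quinary_zero_two (hu 0) (hu 1) (hu 2) (hu 3) (hu 4)
      refine ⟨![x, y, z, w, v], fun h0 => hx (by simpa using congrFun h0 0), ?_⟩
      simp only [hall, Fin.sum_univ_five]
      simpa using hsum
    · push Not at hall
      obtain ⟨l, hl⟩ := hall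
      rw [ne_eq, Bool.not_eq_false] at hl
      have hil : i ≠ l := by rintro rfl; simp [hi] at hl
      have hjl : j ≠ l := by rintro rfl; simp [hj] at hl
      have hkl : k ≠ l := by rintro rfl; simp [hk] at hl
      obtain ⟨x, y, z, w, hx, hsum⟩ :=
        Padic.exists_quaternary_zero_two (hu i) (hu j) (hu k) (hu l)
      refine ⟨Pi.single i x + Pi.single j y + Pi.single k z + Pi.single l w, ?_, ?_⟩
      · intro h0
        apply hx
        simpa [hij, hik, hil] using congrFun h0 i
      · rw [Finset.sum_mul_update_sq hij hik hjk hil hjl hkl]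
        simp only [hi, hj, hk, hl, if_true, Bool.false_eq_true, if_false]
        push_cast
        linear_combination hsum
  · obtain ⟨x, y, z, hz, hsum⟩ := Padic.exists_ternary_zero_of_units hp (hu i) (hu j) (hu k)
    refine ⟨Pi.single i x + Pi.single j y + Pi.single k z + Pi.single l 0, ?_, ?_⟩
    · intro h0
      apply hz
      simpa [hik.symm, hjk.symm] using congrFun h0 k
    · rw [Finset.sum_mul_update_sq hij hik hjk hil hjl hkl]
      simp only [hi, hj, hk, Bool.false_eq_true, if_false]
      linear_combination hsum

end Quinary

open NumberTheorySymbols in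
theorem jacobiSym_eq_one_of_eq_sq_sub (D t : ℤ) (r : ℕ) (X Y : ℤ)
    (hr0 : r ≠ 0) (hr : IsCoprime (r : ℤ) (D * t)) (h : t * r = X ^ 2 - D * Y ^ 2) : J(D | r) = 1 := by
  induction r using Nat.strong_induction_on generalizing X Y with
  | _ r ih =>
  have hrD : IsCoprime (r : ℤ) D := hr.of_mul_right_left
  have hrt : IsCoprime (r : ℤ) t := hr.of_mul_right_right
  by_cases hY : IsCoprime (r : ℤ) Y
  · have hX : IsCoprime (r : ℤ) X := by
      have h1 : IsCoprime (r : ℤ) (X ^ 2) := by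
        have h2 := (hrD.mul_right (hY.pow_right (n := 2))).add_mul_left_right t
        rwa [show D * Y ^ 2 + r * t = X ^ 2 by linarith] at h2
      exact (IsCoprime.pow_right_iff two_pos).1 h1
    have e1 : J(D * Y ^ 2 | r) = J(X ^ 2 | r) := by
      apply jacobiSym.mod_left'
      apply Int.ModEq.symm
      apply Int.modEq_of_dvd
      exact ⟨-t, by linarith⟩
    rw [jacobiSym.mul_left, jacobiSym.sq_one' (Int.isCoprime_iff_gcd_eq_one.1 hY.symm),
      jacobiSym.sq_one' (Int.isCoprime_iff_gcd_eq_one.1 hX.symm), mul_one] at e1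
    exact e1
  · rw [Int.isCoprime_iff_gcd_eq_one] at hY
    obtain ⟨l, hl, hlg⟩ := Nat.exists_prime_and_dvd hY
    have hlr : (l : ℤ) ∣ r := (Int.natCast_dvd_natCast.2 hlg).trans (Int.gcd_dvd_left _ _)
    have hlY : (l : ℤ) ∣ Y := (Int.natCast_dvd_natCast.2 hlg).trans (Int.gcd_dvd_right _ _)
    have hlp : Prime (l : ℤ) := Nat.prime_iff_prime_int.1 hl
    have hlX : (l : ℤ) ∣ X := by
      apply hlp.dvd_of_dvd_pow (n := 2)
      rw [show X ^ 2 = t * r + D * Y ^ 2 by linarith]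
      exact dvd_add (hlr.mul_left _) ((dvd_pow hlY two_ne_zero).mul_left _)
    obtain ⟨Y, rfl⟩ := hlY
    obtain ⟨X, rfl⟩ := hlX
    have hlt : IsCoprime ((l : ℤ) ^ 2) t := (hrt.of_isCoprime_of_dvd_left hlr).pow_left
    have hl2 : (l : ℤ) ^ 2 ∣ r := by
      have : (l : ℤ) ^ 2 ∣ t * r := ⟨X ^ 2 - D * Y ^ 2, by rw [h]; ring⟩
      exact hlt.dvd_of_dvd_mul_left this
    obtain ⟨r', rfl⟩ : l ^ 2 ∣ r := by exact_mod_cast hl2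
    have hl0 : l ≠ 0 := hl.ne_zero
    replace hr0 : r' ≠ 0 := right_ne_zero_of_mul hr0
    have hcop : IsCoprime (r' : ℤ) (D * t) := hr.of_isCoprime_of_dvd_left (by push_cast; exact dvd_mul_left _ _)
    have hlD : IsCoprime D (l : ℤ) := (hrD.of_isCoprime_of_dvd_left hlr).symm
    rw [jacobiSym.mul_right' _ (pow_ne_zero 2 hl0) hr0, jacobiSym.pow_right,
      jacobiSym.sq_one (Int.isCoprime_iff_gcd_eq_one.1 hlD), one_mul]
    refine ih r' ?_ X Y hr0 hcop ?_
    · have := hl.two_le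
      have h1 : 0 < r' := Nat.pos_of_ne_zero hr0
      have h2 : 4 ≤ l ^ 2 := by nlinarith
      nlinarith
    · have : (l : ℤ) ^ 2 ≠ 0 := pow_ne_zero 2 (by exact_mod_cast hl0)
      apply mul_left_cancel₀ this
      push_cast at h
      linear_combination h

section Approximation

theorem Padic.exists_norm_pow_mul_le (p : ℕ) [Fact p.Prime] (C : ℝ) {ε : ℝ} (hε : 0 < ε) :
    ∃ k : ℕ, ‖(p : ℚ_[p]) ^ k‖ * C < ε := by
  have h1 : ‖(p : ℚ_[p])‖ < 1 := Padic.norm_p_lt_one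
  have hC : 0 < |C| + 1 := by positivity
  obtain ⟨k, hk⟩ := exists_pow_lt_of_lt_one (div_pos hε hC) h1
  refine ⟨k, ?_⟩
  rw [norm_pow]
  rw [lt_div_iff₀ hC] at hk
  refine lt_of_le_of_lt ?_ hk
  have h0 : 0 ≤ ‖(p : ℚ_[p])‖ ^ k := by positivity
  nlinarith [le_abs_self C]

/-- Simultaneous approximation of `p`-adic integers, for `p ∣ T`, by a large integer. -/
theorem exists_int_padic_approx (T : ℕ) (hT : T ≠ 0) (z : ∀ (p : ℕ) [Fact p.Prime], ℤ_[p])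
    (ε : ∀ (p : ℕ) [Fact p.Prime], ℝ) (hε : ∀ (p : ℕ) [Fact p.Prime], 0 < ε p) (B : ℤ) :
    ∃ Z : ℤ, B ≤ Z ∧ ∀ (p : ℕ) [Fact p.Prime], p ∣ T → ‖(Z : ℚ_[p]) - z p‖ < ε p := by
  have hK : ∀ (p : ℕ) [Fact p.Prime], ∃ k : ℕ, ‖(p : ℚ_[p]) ^ k‖ < ε p := fun p _ => by
    simpa using Padic.exists_norm_pow_mul_le p 1 (hε p)
  choose K hK using hK
  let s : ℕ → ℕ := fun p => if h : p.Prime then p ^ (haveI := Fact.mk h; K p) else 1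
  let r : ℕ → ℕ := fun p => if h : p.Prime then (haveI := Fact.mk h; (z p).appr (K p)) else 0
  have hs : ∀ p ∈ T.primeFactors, s p ≠ 0 := fun p hp => by
    have hpp := Nat.prime_of_mem_primeFactors hp
    simp only [s, hpp, dif_pos]
    exact pow_ne_zero _ hpp.ne_zero
  have hpair : Set.Pairwise (T.primeFactors : Set ℕ) (Function.onFun Nat.Coprime s) := by
    intro p hp q hq hpq
    have hpp := Nat.prime_of_mem_primeFactors hp
    have hqq := Nat.prime_of_mem_primeFactors hq
    simp only [Function.onFun, s, hpp, hqq, dif_pos]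
    exact Nat.Coprime.pow _ _ ((Nat.coprime_primes hpp hqq).2 hpq)
  obtain ⟨k, hk⟩ := Nat.chineseRemainderOfFinset r s T.primeFactors hs hpair
  refine ⟨k + (∏ p ∈ T.primeFactors, s p : ℕ) * |B|, ?_, ?_⟩
  · have : 0 < ∏ p ∈ T.primeFactors, s p := Nat.pos_of_ne_zero (Finset.prod_ne_zero_iff.2 hs)
    have h1 : (1 : ℤ) ≤ (∏ p ∈ T.primeFactors, s p : ℕ) := by exact_mod_cast this
    nlinarith [le_abs_self B, abs_nonneg B]
  · intro p hpF hpT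
    have hmem : p ∈ T.primeFactors := Nat.mem_primeFactors.2 ⟨hpF.out, hpT, hT⟩
    have h1 := hk p hmem
    have hsp : s p = p ^ K p := by simp [s, hpF.out]
    have hrp : r p = (z p).appr (K p) := by simp [r, hpF.out]
    rw [hsp, hrp] at h1
    have h2 : ((p : ℤ) ^ K p) ∣ k + (∏ p ∈ T.primeFactors, s p : ℕ) * |B| - (z p).appr (K p) := by
      rw [add_sub_right_comm]
      refine dvd_add ?_ (Dvd.dvd.mul_right ?_ _)
      · have := (Nat.modEq_iff_dvd.1 h1.symm)
        exact_mod_cast this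
      · have := hsp ▸ Finset.dvd_prod_of_mem s hmem
        exact_mod_cast this
    obtain ⟨v, hv⟩ := h2
    obtain ⟨w, hw⟩ := Ideal.mem_span_singleton.1 (PadicInt.appr_spec (K p) (z p))
    set Z : ℤ := k + (∏ p ∈ T.primeFactors, s p : ℕ) * |B|
    have e1 : (Z : ℚ_[p]) - z p = (p : ℚ_[p]) ^ K p * ((v - w : ℤ_[p]) : ℚ_[p]) := by
      have a1 := congrArg (Int.cast : ℤ → ℚ_[p]) hv
      have a2 := congrArg (Subtype.val) hw
      push_cast at a1 a2 ⊢
      linear_combination a1 - a2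
    rw [e1, norm_mul]
    have h3 : ‖((v - w : ℤ_[p]) : ℚ_[p])‖ ≤ 1 := PadicInt.norm_le_one _
    exact lt_of_le_of_lt (mul_le_of_le_one_right (norm_nonneg _) h3) (hK p)

theorem Int.natCast_dvd_of_forall_padic_norm_le {V : ℕ} {u : ℤ}
    (h : ∀ (p : ℕ) [Fact p.Prime], p ∣ V → ‖(u : ℚ_[p])‖ ≤ ‖(V : ℚ_[p])‖) : (V : ℤ) ∣ u := by
  rw [Int.natCast_dvd, Nat.dvd_iff_prime_pow_dvd_dvd]
  intro p k hp hk
  rcases Nat.eq_zero_or_pos k with rfl | hk0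
  · simp
  have : Fact p.Prime := ⟨hp⟩
  have h1 := h p ((dvd_pow_self p hk0.ne').trans hk)
  have h2 : ‖((V : ℤ) : ℚ_[p])‖ ≤ (p : ℝ) ^ (-k : ℤ) :=
    (Padic.norm_int_le_pow_iff_dvd _ _).2 (by exact_mod_cast hk)
  rw [Int.cast_natCast] at h2
  have h3 := (Padic.norm_int_le_pow_iff_dvd _ _).1 (h1.trans h2)
  rw [← Int.natCast_dvd]
  exact_mod_cast h3

theorem Padic.norm_le_norm_of_dvd {p : ℕ} [Fact p.Prime] {u v : ℤ} (h : u ∣ v) :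
    ‖(v : ℚ_[p])‖ ≤ ‖(u : ℚ_[p])‖ := by
  obtain ⟨w, rfl⟩ := h
  push_cast
  rw [norm_mul]
  exact mul_le_of_le_one_right (norm_nonneg _) (Padic.norm_int_le_one w)

end Approximation

/-- Some nonzero element of `K` is represented both by `c z² + d w²` and by `n² - e x²`. -/
def HasCommonValue (K : Type*) [Field K] (c d e : K) : Prop :=
  ∃ z w n x : K, c * z ^ 2 + d * w ^ 2 = n ^ 2 - e * x ^ 2 ∧ c * z ^ 2 + d * w ^ 2 ≠ 0

section CommonValue

theorem HasCommonValue.mul_sq {K : Type*} [Field K] {c d e s : K} (hs : s ≠ 0)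
    (h : HasCommonValue K c d e) : HasCommonValue K c d (e * s ^ 2) := by
  obtain ⟨z, w, n, x, h, h0⟩ := h
  refine ⟨z, w, n, x / s, ?_, h0⟩
  rw [h]; field_simp

theorem exists_eq_of_binary_zero {K : Type*} [Field K] (h2 : (2 : K) ≠ 0) {a b x y : K}
    (ha : a ≠ 0) (hb : b ≠ 0) (hxy : x ≠ 0 ∨ y ≠ 0) (h : a * x ^ 2 + b * y ^ 2 = 0) (t : K) :
    ∃ X Y : K, a * X ^ 2 + b * Y ^ 2 = t := by
  have hy : y ≠ 0 := by
    rintro rfl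
    have : x = 0 := by simpa [ha] using h
    tauto
  have hx : x ≠ 0 := by
    rintro rfl
    have : y = 0 := by simpa [hb] using h
    tauto
  have hb' : b = -(a * x ^ 2) / y ^ 2 := by
    field_simp; linear_combination h
  refine ⟨(t / a + 1) / 2, y * ((t / a - 1) / 2) / x, ?_⟩
  rw [hb']
  field_simp
  ring

variable {p : ℕ} [Fact p.Prime]

theorem Padic.exists_hasCommonValue {a b c d : ℚ_[p]} (ha : a ≠ 0) (hb : b ≠ 0) (hc : c ≠ 0)
    (hd : d ≠ 0) : ∃ x y : ℚ_[p], a * x ^ 2 + b * y ^ 2 ≠ 0 ∧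
      HasCommonValue ℚ_[p] c d (a * x ^ 2 + b * y ^ 2) := by
  have h2 : (2 : ℚ_[p]) ≠ 0 := two_ne_zero
  obtain ⟨v, hv, hsum⟩ := Padic.exists_quinary_zero ![a, b, c, d, -1] (by
    intro i; fin_cases i <;> simp [ha, hb, hc, hd])
  obtain ⟨x, y, z, w, n, rfl⟩ : ∃ x y z w n, v = ![x, y, z, w, n] :=
    ⟨v 0, v 1, v 2, v 3, v 4, by funext i; fin_cases i <;> rfl⟩
  have h : a * x ^ 2 + b * y ^ 2 + c * z ^ 2 + d * w ^ 2 - n ^ 2 = 0 := by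
    have : a * x ^ 2 + b * y ^ 2 + c * z ^ 2 + d * w ^ 2 + -n ^ 2 = 0 := by
      simpa [Fin.sum_univ_five] using hsum
    linear_combination this
  have hv' : x ≠ 0 ∨ y ≠ 0 ∨ z ≠ 0 ∨ w ≠ 0 ∨ n ≠ 0 := by
    by_contra hcon
    push Not at hcon
    obtain ⟨rfl, rfl, rfl, rfl, rfl⟩ := hcon
    apply hv
    funext i; fin_cases i <;> rfl
  have huniv : ∀ z w : ℚ_[p], (z ≠ 0 ∨ w ≠ 0) → c * z ^ 2 + d * w ^ 2 = 0 →
      ∃ x y : ℚ_[p], a * x ^ 2 + b * y ^ 2 ≠ 0 ∧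
        HasCommonValue ℚ_[p] c d (a * x ^ 2 + b * y ^ 2) := by
    intro z w hzw h0
    obtain ⟨Z, W, hZW⟩ := exists_eq_of_binary_zero h2 hc hd hzw h0 (-a)
    exact ⟨1, 0, by simpa using ha, Z, W, 0, 1, by rw [hZW]; ring, by rw [hZW]; simpa using ha⟩
  by_cases hE : a * x ^ 2 + b * y ^ 2 = 0
  · by_cases hxy : x ≠ 0 ∨ y ≠ 0
    · obtain ⟨X, Y, hXY⟩ := exists_eq_of_binary_zero h2 ha hb hxy hE (-c)
      refine ⟨X, Y, by rw [hXY]; simpa using hc, 1, 0, 0, 1, by rw [hXY]; ring, by simpa using hc⟩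
    · push Not at hxy
      obtain ⟨rfl, rfl⟩ := hxy
      by_cases hn : n = 0
      · subst hn
        exact huniv z w (by tauto) (by linear_combination h)
      · refine ⟨1, 0, by simpa using ha, z, w, n, 0, by linear_combination h, ?_⟩
        rw [show c * z ^ 2 + d * w ^ 2 = n ^ 2 by linear_combination h]
        exact pow_ne_zero 2 hn
  · by_cases hM : c * z ^ 2 + d * w ^ 2 = 0
    · by_cases hzw : z ≠ 0 ∨ w ≠ 0
      · exact huniv z w hzw hM
      · -- here `a x² + b y²` is a nonzero square, so `n² - e x²` is universal
        have hn : n ^ 2 = a * x ^ 2 + b * y ^ 2 := by linear_combination -h + hM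
        refine ⟨x, y, hE, 1, 0, (c + 1) / 2, (c - 1) / 2 / n, ?_, by simpa using hc⟩
        have hn0 : n ≠ 0 := by
          rintro rfl
          exact hE (by rw [← hn]; ring)
        rw [← hn]
        field_simp
        ring
    · exact ⟨x, y, hE, z, w, n, 1, by linear_combination h, hM⟩

theorem Padic.exists_coe_eq_pow_mul (x y : ℚ_[p]) : ∃ k : ℕ, ∃ X Y : ℤ_[p],
    (X : ℚ_[p]) = p ^ k * x ∧ (Y : ℚ_[p]) = p ^ k * y := by
  obtain ⟨k, hk⟩ := Padic.exists_norm_pow_mul_le p (‖x‖ + ‖y‖) one_pos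
  have h0 := norm_nonneg ((p : ℚ_[p]) ^ k)
  refine ⟨k, ⟨p ^ k * x, ?_⟩, ⟨p ^ k * y, ?_⟩, rfl, rfl⟩ <;> rw [norm_mul] <;>
    nlinarith [mul_nonneg h0 (norm_nonneg x), mul_nonneg h0 (norm_nonneg y)]

theorem Padic.hasCommonValue_of_units (hp : p ≠ 2) {c d e : ℤ} (hc : ¬ (p : ℤ) ∣ c)
    (hd : ¬ (p : ℤ) ∣ d) : HasCommonValue ℚ_[p] c d e := by
  have hu : ∀ u : ℤ, ¬ (p : ℤ) ∣ u → ‖(u : ℤ_[p])‖ = 1 := fun u hu => by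
    rw [← PadicInt.norm_int_lt_one_iff_dvd] at hu
    exact le_antisymm (PadicInt.norm_le_one _) (not_lt.1 hu)
  obtain ⟨x, y, z, hz, h⟩ := Padic.exists_ternary_zero_of_units hp (hu c hc) (hu d hd)
    (c := -1) (by simp)
  push_cast at h
  have h' : (c : ℚ_[p]) * x ^ 2 + d * y ^ 2 = z ^ 2 := by linear_combination h
  exact ⟨x, y, z, 0, by rw [h']; ring, by rw [h']; exact pow_ne_zero 2 hz⟩

theorem Padic.ternaryIsotropic_of_units (hp : p ≠ 2) {a b : ℤ} (ha : ¬ (p : ℤ) ∣ a)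
    (hb : ¬ (p : ℤ) ∣ b) : TernaryIsotropic ℚ_[p] a b := by
  obtain ⟨x, y, n, z, h, h0⟩ := Padic.hasCommonValue_of_units hp (e := 0) ha hb
  refine ⟨x, y, n, ?_, by rw [h]; simp⟩
  by_contra hcon
  push Not at hcon
  apply h0
  simp [hcon.1, hcon.2.1]

theorem Padic.isSquare_of_jacobiSym_eq_one (hp : p ≠ 2) {a : ℤ} (h : jacobiSym a p = 1) :
    IsSquare (a : ℚ_[p]) := by
  have hpa : (a : ZMod p) ≠ 0 := by
    intro h0
    rw [← jacobiSym.legendreSym.to_jacobiSym, (legendreSym.eq_zero_iff p a).2 h0] at h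
    exact zero_ne_one h
  obtain ⟨t, ht⟩ := ZMod.isSquare_of_jacobiSym_eq_one h
  obtain ⟨t, rfl⟩ := ZMod.intCast_surjective t
  have ht0 : (t : ZMod p) ≠ 0 := by
    intro h0; rw [h0] at ht; exact hpa (by simpa using ht)
  have hdvd : (p : ℤ) ∣ a - t ^ 2 := by
    rw [← ZMod.intCast_zmod_eq_zero_iff_dvd]
    push_cast
    rw [ht]; ring
  have htn : ‖(t : ℚ_[p])‖ = 1 := by
    rw [ne_eq, ZMod.intCast_zmod_eq_zero_iff_dvd, ← Padic.norm_intCast_lt_one_iff] at ht0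
    exact le_antisymm (Padic.norm_int_le_one _) (not_lt.1 ht0)
  have htq : (t : ℚ_[p]) ≠ 0 := by
    intro h0; rw [h0, norm_zero] at htn; exact zero_ne_one htn
  obtain ⟨s, -, hs⟩ := Padic.exists_eq_sq_mul (u := (a : ℚ_[p])) (v := (t : ℚ_[p]) ^ 2)
    (pow_ne_zero 2 htq) (by
      rw [Padic.norm_two_of_ne_two hp, norm_pow, htn]
      have := Padic.norm_intCast_lt_one_iff.2 hdvd
      push_cast at this
      simpa using this)
  exact ⟨t * s, by rw [hs]; ring⟩

end CommonValue

open NumberTheorySymbols in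
theorem jacobiSym_eq_one_of_modEq {D : ℤ} {r q : ℕ} (hr : Odd r) (hq : Odd q)
    (h : q ≡ r [MOD 4 * D.natAbs]) (h1 : J(D | r) = 1) : J(D | q) = 1 := by
  rw [jacobiSym.mod_right D hq, h, ← jacobiSym.mod_right D hr, h1]

open NumberTheorySymbols in
/-- If `c z² + d w²` and `n² - e x²` are positive and sufficiently congruent, then some number
`P q` with `q` prime and `P` composed of the bad primes is close to both of them, in such a way
that `-c d` and `e` are quadratic residues modulo `q`. -/
theorem exists_prime_jacobiSym_eq_one {c d e z w n x : ℤ} {M M' P S L K : ℕ}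
    (hM : (M : ℤ) = c * z ^ 2 + d * w ^ 2) (hM' : (M' : ℤ) = n ^ 2 - e * x ^ 2)
    (hM0 : M ≠ 0) (hM'0 : M' ≠ 0) (hMM : (L : ℤ) ∣ M - M') (hL : L ≠ 0)
    (hcd : 4 * (c * d).natAbs ∣ S) (he : 4 * e.natAbs ∣ S) (hLS : L ∣ S ^ K)
    (hP : P = M.gcd L) (hPS : P * S ∣ L) (B : ℕ) :
    ∃ q : ℕ, B < q ∧ q.Prime ∧ (L : ℤ) ∣ P * q - M ∧ J(-(c * d) | q) = 1 ∧ J(e | q) = 1 := by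
  have hP0 : P ≠ 0 := by rw [hP]; exact Nat.gcd_ne_zero_right hL
  have hPpos : 0 < P := Nat.pos_of_ne_zero hP0
  obtain ⟨r, hr⟩ : P ∣ M := hP ▸ Nat.gcd_dvd_left _ _
  obtain ⟨R, hR⟩ : P ∣ L := hP ▸ Nat.gcd_dvd_right _ _
  have hR0 : R ≠ 0 := by rintro rfl; exact hL (by simp [hR])
  have hcop : Nat.Coprime r R := by
    have h1 : P * r.gcd R = P * 1 := by rw [← Nat.gcd_mul_left, ← hr, ← hR, mul_one, ← hP]
    exact Nat.eq_of_mul_eq_mul_left hPpos h1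
  obtain ⟨r', hr'⟩ : P ∣ M' := by
    have h1 : (P : ℤ) ∣ M - M' := (Int.natCast_dvd_natCast.2 ⟨R, hR⟩).trans hMM
    have h2 : (P : ℤ) ∣ M := Int.natCast_dvd_natCast.2 ⟨r, hr⟩
    exact Int.natCast_dvd_natCast.1 ((dvd_sub_right h2).1 h1)
  have hPz : (P : ℤ) ≠ 0 := by exact_mod_cast hP0
  have hrr : (R : ℤ) ∣ r - r' := by
    rw [hR, hr, hr'] at hMM
    push_cast at hMM
    rw [← mul_sub] at hMM
    exact (mul_dvd_mul_iff_left hPz).1 hMM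
  have hSR : S ∣ R := by
    rw [hR] at hPS
    exact Nat.dvd_of_mul_dvd_mul_left hPpos hPS
  have hrr' : r ≡ r' [MOD R] := (Nat.modEq_iff_dvd.2 hrr).symm
  have hcop' : Nat.Coprime r' R := by
    rw [Nat.Coprime, ← hrr'.gcd_eq]; exact hcop
  obtain ⟨q, hqB, hq, hqr⟩ := Nat.forall_exists_prime_gt_and_zmodEq B (q := R) (a := r) hR0
    (Nat.isCoprime_iff_coprime.2 hcop)
  have hqr' : q ≡ r [MOD R] := Int.natCast_modEq_iff.1 hqr
  have hqR : Nat.Coprime q R := by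
    rw [Nat.Coprime, hqr'.gcd_eq]; exact hcop
  have hPL : P ∣ S ^ K := (Dvd.intro _ hR.symm).trans hLS
  have hodd : ∀ t, Nat.Coprime t R → Odd t := fun t ht => by
    have h2 : 2 ∣ R := ((Dvd.intro _ (by ring : 2 * (2 * (c * d).natAbs) = _)).trans hcd).trans hSR
    exact Nat.coprime_two_right.1 (ht.coprime_dvd_right h2)
  have hzS : ∀ t, Nat.Coprime t R → ∀ u : ℤ, u.natAbs ∣ S → IsCoprime (t : ℤ) u := by
    intro t ht u hu
    rw [Int.isCoprime_iff_gcd_eq_one]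
    exact ht.coprime_dvd_right (hu.trans hSR)
  have hzP : ∀ t, Nat.Coprime t R → IsCoprime (t : ℤ) P := by
    intro t ht
    rw [Nat.isCoprime_iff_coprime]
    exact Nat.Coprime.coprime_dvd_right hPL ((ht.coprime_dvd_right hSR).pow_right K)
  have hcdS : (c * d).natAbs ∣ S := (Dvd.intro_left _ rfl).trans hcd
  have hcS : c.natAbs ∣ S := (by rw [Int.natAbs_mul]; exact dvd_mul_right _ _ : _ ∣ _).trans hcdS
  have heS : e.natAbs ∣ S := (Dvd.intro_left _ rfl).trans he
  refine ⟨q, hqB, hq, ?_, ?_, ?_⟩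
  · rw [hR, hr]
    push_cast
    rw [← mul_sub]
    exact mul_dvd_mul_left _ (Int.modEq_iff_dvd.1 hqr.symm)
  · refine jacobiSym_eq_one_of_modEq (hodd r hcop) (hodd q hqR) ?_ ?_
    · rw [Int.natAbs_neg]
      exact hqr'.of_dvd (hcd.trans hSR)
    · refine jacobiSym_eq_one_of_eq_sq_sub _ (c * P) r (c * z) w ?_ ?_ ?_
      · rintro rfl; exact hM0 (by simp [hr])
      · refine IsCoprime.mul_right ?_ (IsCoprime.mul_right ?_ (hzP r hcop))
        · exact hzS r hcop _ (by rwa [Int.natAbs_neg])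
        · exact hzS r hcop _ hcS
      · rw [hr] at hM
        push_cast at hM
        linear_combination c * hM
  · refine jacobiSym_eq_one_of_modEq (hodd r' hcop') (hodd q hqR) ?_ ?_
    · exact (hqr'.trans hrr').of_dvd (he.trans hSR)
    · refine jacobiSym_eq_one_of_eq_sq_sub _ P r' n x ?_ ?_ ?_
      · rintro rfl; exact hM'0 (by simp [hr'])
      · exact (hzS r' hcop' _ heS).mul_right (hzP r' hcop')
      · rw [hr'] at hM'
        push_cast at hM'
        linear_combination hM'

/-- Weak approximation for the values of a binary diagonal form. -/
theorem exists_int_binary_approx (T : ℕ) (hT : T ≠ 0) (a b : ℤ)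
    (x y : ∀ (p : ℕ) [Fact p.Prime], ℤ_[p]) (ε : ∀ (p : ℕ) [Fact p.Prime], ℝ)
    (hε : ∀ (p : ℕ) [Fact p.Prime], 0 < ε p) :
    ∃ Y : ℤ, ∀ B : ℤ, ∃ X : ℤ, B ≤ X ∧ ∀ (p : ℕ) [Fact p.Prime], p ∣ T →
      ‖((a * X ^ 2 + b * Y ^ 2 : ℤ) : ℚ_[p]) - (a * (x p : ℚ_[p]) ^ 2 + b * (y p : ℚ_[p]) ^ 2)‖
        < ε p := by
  have hδ : ∀ (p : ℕ) [Fact p.Prime], ∃ δ : ℝ, 0 < δ ∧ ∀ X Y : ℚ_[p], ‖X - x p‖ < δ →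
      ‖Y - y p‖ < δ →
      ‖(a * X ^ 2 + b * Y ^ 2) - (a * (x p : ℚ_[p]) ^ 2 + b * (y p : ℚ_[p]) ^ 2)‖ < ε p := by
    intro p _
    have hc : Continuous (fun v : ℚ_[p] × ℚ_[p] => (a : ℚ_[p]) * v.1 ^ 2 + b * v.2 ^ 2) := by
      fun_prop
    obtain ⟨δ, hδ, h⟩ := Metric.continuous_iff.1 hc ((x p : ℚ_[p]), (y p : ℚ_[p])) (ε p) (hε p)
    refine ⟨δ, hδ, fun X Y hX hY => ?_⟩
    have := h (X, Y) (by
      rw [Prod.dist_eq, dist_eq_norm, dist_eq_norm]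
      exact max_lt hX hY)
    rwa [dist_eq_norm] at this
  choose δ hδ h using hδ
  obtain ⟨Y, -, hY⟩ := exists_int_padic_approx T hT y δ hδ 0
  refine ⟨Y, fun B => ?_⟩
  obtain ⟨X, hXB, hX⟩ := exists_int_padic_approx T hT x δ hδ B
  refine ⟨X, hXB, fun p _ hp => ?_⟩
  push_cast
  exact h p X Y (hX p hp) (hY p hp)

theorem HasCommonValue.of_norm_sub_lt {p : ℕ} [Fact p.Prime] {c d e e' : ℚ_[p]} (he : e ≠ 0)
    (h : HasCommonValue ℚ_[p] c d e) (hee : ‖e' - e‖ < ‖(2 : ℚ_[p])‖ ^ 2 * ‖e‖) :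
    HasCommonValue ℚ_[p] c d e' := by
  obtain ⟨s, hs, rfl⟩ := Padic.exists_eq_sq_mul he hee
  exact h.mul_sq hs

theorem exists_int_hasCommonValue {a b c d : ℤ} (ha : 0 < a) (hb : 0 < b) (hc : 0 < c)
    (hd : 0 < d) : ∃ x y : ℤ, 0 < a * x ^ 2 + b * y ^ 2 ∧ ∀ (p : ℕ) [Fact p.Prime],
      HasCommonValue ℚ_[p] c d ((a * x ^ 2 + b * y ^ 2 : ℤ) : ℚ_[p]) := by
  have hloc : ∀ (p : ℕ) [Fact p.Prime], ∃ x y : ℤ_[p],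
      (a * (x : ℚ_[p]) ^ 2 + b * (y : ℚ_[p]) ^ 2 ≠ 0) ∧
        HasCommonValue ℚ_[p] c d (a * (x : ℚ_[p]) ^ 2 + b * (y : ℚ_[p]) ^ 2) := by
    intro p hpF
    obtain ⟨x, y, h0, h⟩ := Padic.exists_hasCommonValue (p := p) (a := a) (b := b) (c := c)
      (d := d) (by exact_mod_cast ha.ne') (by exact_mod_cast hb.ne') (by exact_mod_cast hc.ne')
      (by exact_mod_cast hd.ne')
    obtain ⟨k, X, Y, hX, hY⟩ := Padic.exists_coe_eq_pow_mul x y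
    have hpk : (p : ℚ_[p]) ^ k ≠ 0 := pow_ne_zero _ (by exact_mod_cast hpF.out.ne_zero)
    have e1 : a * (X : ℚ_[p]) ^ 2 + b * (Y : ℚ_[p]) ^ 2
        = (a * x ^ 2 + b * y ^ 2) * ((p : ℚ_[p]) ^ k) ^ 2 := by
      rw [hX, hY]; ring
    refine ⟨X, Y, ?_, ?_⟩
    · rw [e1]; exact mul_ne_zero h0 (pow_ne_zero 2 hpk)
    · rw [e1]; exact h.mul_sq hpk
  choose x y h0 h using hloc
  have hT : (2 * c * d).natAbs ≠ 0 := by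
    rw [Int.natAbs_ne_zero]; positivity
  obtain ⟨Y, hY⟩ := exists_int_binary_approx (2 * c * d).natAbs hT a b x y
    (fun p _ => ‖(2 : ℚ_[p])‖ ^ 2 *
      ‖a * (x p : ℚ_[p]) ^ 2 + b * (y p : ℚ_[p]) ^ 2‖)
    (fun p _ => mul_pos (pow_pos (norm_pos_iff.2 two_ne_zero) 2) (norm_pos_iff.2 (h0 p)))
  obtain ⟨X, hX1, hX⟩ := hY 1
  refine ⟨X, Y, by positivity, fun p hpF => ?_⟩
  by_cases hp : p ∣ (2 * c * d).natAbs
  · exact (h p).of_norm_sub_lt (h0 p) (hX p hp)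
  · rw [← Int.natCast_dvd] at hp
    refine Padic.hasCommonValue_of_units ?_ ?_ ?_
    · rintro rfl
      exact hp ⟨c * d, by push_cast; ring⟩
    · exact fun hpc => hp ((hpc.mul_left 2).mul_right d)
    · exact fun hpd => hp (hpd.mul_left _)

theorem exists_int_pow_norm_lt {T : ℕ} (hT : T ≠ 0) (ε : ∀ (p : ℕ) [Fact p.Prime], ℝ)
    (hε : ∀ (p : ℕ) [Fact p.Prime], 0 < ε p) :
    ∃ K : ℕ, ∀ (p : ℕ) [Fact p.Prime], p ∣ T → ‖((T ^ K : ℕ) : ℚ_[p])‖ < ε p := by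
  have hK : ∀ (p : ℕ) [Fact p.Prime], ∃ k : ℕ, ‖(p : ℚ_[p]) ^ k‖ < ε p := fun p _ => by
    simpa using Padic.exists_norm_pow_mul_le p 1 (hε p)
  choose K hK using hK
  let k : ℕ → ℕ := fun p => if h : p.Prime then (haveI := Fact.mk h; K p) else 0
  refine ⟨T.primeFactors.sup k, fun p hpF hp => ?_⟩
  have h1 : K p ≤ T.primeFactors.sup k := by
    have := Finset.le_sup (f := k) (Nat.mem_primeFactors.2 ⟨hpF.out, hp, hT⟩)
    simpa [k, hpF.out] using this
  refine lt_of_le_of_lt ?_ (hK p)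
  have h2 := Padic.norm_le_norm_of_dvd (p := p) (u := (p : ℤ) ^ K p)
    (v := (T : ℤ) ^ T.primeFactors.sup k)
    ((pow_dvd_pow_of_dvd (Int.natCast_dvd_natCast.2 hp) _).trans (pow_dvd_pow _ h1))
  push_cast at h2 ⊢
  exact h2

theorem Padic.norm_sub_le_max {p : ℕ} [Fact p.Prime] (x y : ℚ_[p]) : ‖x - y‖ ≤ max ‖x‖ ‖y‖ := by
  rw [sub_eq_add_neg, ← norm_neg y]
  exact IsUltrametricDist.norm_add_le_max x (-y)

theorem HasCommonValue.exists_integral {p : ℕ} [hp : Fact p.Prime] {c d e : ℚ_[p]}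
    (h : HasCommonValue ℚ_[p] c d e) : ∃ z w n x : ℤ_[p],
      c * (z : ℚ_[p]) ^ 2 + d * (w : ℚ_[p]) ^ 2 = (n : ℚ_[p]) ^ 2 - e * (x : ℚ_[p]) ^ 2 ∧
        c * (z : ℚ_[p]) ^ 2 + d * (w : ℚ_[p]) ^ 2 ≠ 0 := by
  obtain ⟨z, w, n, x, h, h0⟩ := h
  obtain ⟨k, Z, W, hZ, hW⟩ := Padic.exists_coe_eq_pow_mul z w
  obtain ⟨l, N, X, hN, hX⟩ := Padic.exists_coe_eq_pow_mul n x
  have hp0 : (p : ℚ_[p]) ≠ 0 := by exact_mod_cast hp.out.ne_zero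
  have key : c * ((p ^ l * Z : ℤ_[p]) : ℚ_[p]) ^ 2 + d * ((p ^ l * W : ℤ_[p]) : ℚ_[p]) ^ 2
      = (c * z ^ 2 + d * w ^ 2) * ((p : ℚ_[p]) ^ l * p ^ k) ^ 2 := by
    push_cast
    rw [hZ, hW]; ring
  refine ⟨p ^ l * Z, p ^ l * W, p ^ k * N, p ^ k * X, ?_, ?_⟩
  · rw [key, h]
    push_cast
    rw [hN, hX]; ring
  · rw [key]
    exact mul_ne_zero h0 (pow_ne_zero 2 (mul_ne_zero (pow_ne_zero _ hp0) (pow_ne_zero _ hp0)))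

theorem ternaryIsotropic_real {a b : ℝ} (ha : 0 ≤ a) : TernaryIsotropic ℝ a b :=
  TernaryIsotropic.of_isSquare ⟨√a, (Real.mul_self_sqrt ha).symm⟩

open NumberTheorySymbols in
/-- A common value, up to squares, of `c z² + d w²` and `n² - e x²` at all the bad primes that is
a product of bad primes and a suitable further prime is a global common value. -/
theorem ternaryIsotropic_of_local {c d e : ℤ} (hc : 0 < c) (hd : 0 < d) (he : 0 < e) {P q : ℕ}
    (hP : P ≠ 0) (hq : q.Prime)
    (hPT : ∀ p : ℕ, p.Prime → p ∣ P → p ∣ (2 * c * d * e).natAbs)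
    (hcd : J(-(c * d) | q) = 1) (heq : J(e | q) = 1)
    (hloc : ∀ (p : ℕ) [Fact p.Prime], p ∣ (2 * c * d * e).natAbs →
      ∃ z w n x : ℚ_[p], c * z ^ 2 + d * w ^ 2 = n ^ 2 - e * x ^ 2 ∧
        ‖((P * q : ℤ) : ℚ_[p]) - (c * z ^ 2 + d * w ^ 2)‖ <
          ‖(2 : ℚ_[p])‖ ^ 2 * ‖c * z ^ 2 + d * w ^ 2‖) :
    TernaryIsotropic ℚ (e : ℤ) ((P * q : ℤ) : ℚ) ∧
      TernaryIsotropic ℚ ((c * (P * q) : ℤ) : ℚ) ((d * (P * q) : ℤ) : ℚ) := by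
  have hm : (0 : ℤ) < P * q := by
    have := hq.pos
    have := Nat.pos_of_ne_zero hP
    positivity
  have hnd : ∀ p : ℕ, p.Prime → ¬ p ∣ (2 * c * d * e).natAbs → p ≠ q →
      ¬ (p : ℤ) ∣ c ∧ ¬ (p : ℤ) ∣ d ∧ ¬ (p : ℤ) ∣ e ∧ ¬ (p : ℤ) ∣ P * q := by
    intro p hp hpT hpq
    have hpT' := hpT
    rw [← Int.natCast_dvd] at hpT'
    refine ⟨fun h => hpT' ?_, fun h => hpT' ?_, fun h => hpT' ?_, fun h => ?_⟩
    · exact ((h.mul_left 2).mul_right d).mul_right e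
    · exact (h.mul_left _).mul_right e
    · exact h.mul_left _
    · rcases (Nat.prime_iff_prime_int.1 hp).dvd_or_dvd h with h | h
      · exact hpT (hPT p hp (Int.natCast_dvd_natCast.1 h))
      · exact hpq ((Nat.prime_dvd_prime_iff_eq hp hq).1 (Int.natCast_dvd_natCast.1 h))
  have hlocal : ∀ (p : ℕ) [Fact p.Prime], p ∣ (2 * c * d * e).natAbs →
      ∃ z w n x s : ℚ_[p], c * z ^ 2 + d * w ^ 2 = n ^ 2 - e * x ^ 2 ∧
        c * z ^ 2 + d * w ^ 2 ≠ 0 ∧ s ≠ 0 ∧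
        ((P * q : ℤ) : ℚ_[p]) = (c * z ^ 2 + d * w ^ 2) * s ^ 2 := by
    intro p _ hp
    obtain ⟨z, w, n, x, h1, h2⟩ := hloc p hp
    have h0 : c * z ^ 2 + d * w ^ 2 ≠ 0 := by
      intro h0
      rw [h0] at h2
      simp only [norm_zero, mul_zero] at h2
      exact absurd h2 (not_lt.2 (norm_nonneg _))
    obtain ⟨s, hs, h⟩ := Padic.exists_eq_sq_mul h0 h2
    exact ⟨z, w, n, x, s, h1, h0, hs, h⟩
  constructor
  · refine ternaryIsotropic_rat e (P * q) he.ne' hm.ne' ?_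
      (ternaryIsotropic_real (by exact_mod_cast he.le))
    intro p hpF hp2
    by_cases hpT : p ∣ (2 * c * d * e).natAbs
    · obtain ⟨z, w, n, x, s, h1, h0, hs, h⟩ := hlocal p hpT
      rw [h]
      exact TernaryIsotropic.mul_sq hs ⟨x, 1, n, Or.inr (Or.inl one_ne_zero), by rw [h1]; ring⟩
    · by_cases hpq : p = q
      · subst hpq
        exact TernaryIsotropic.of_isSquare (Padic.isSquare_of_jacobiSym_eq_one hp2 heq)
      · obtain ⟨-, -, h3, h4⟩ := hnd p hpF.out hpT hpq
        exact Padic.ternaryIsotropic_of_units hp2 h3 h4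
  · refine ternaryIsotropic_rat (c * (P * q)) (d * (P * q)) (mul_pos hc hm).ne'
      (mul_pos hd hm).ne' ?_ (ternaryIsotropic_real (by exact_mod_cast (mul_pos hc hm).le))
    intro p hpF hp2
    by_cases hpT : p ∣ (2 * c * d * e).natAbs
    · obtain ⟨z, w, n, x, s, h1, h0, hs, h⟩ := hlocal p hpT
      refine ⟨z, w, (c * z ^ 2 + d * w ^ 2) * s, ?_, ?_⟩
      · by_contra hcon
        push Not at hcon
        apply h0
        simp [hcon.1, hcon.2]
      · rw [Int.cast_mul c, Int.cast_mul d, h]; ring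
    · by_cases hpq : p = q
      · subst hpq
        obtain ⟨s, hs⟩ := Padic.isSquare_of_jacobiSym_eq_one hp2 hcd
        refine ⟨s, c, 0, Or.inr (Or.inl (by exact_mod_cast hc.ne')), ?_⟩
        push_cast at hs ⊢
        linear_combination -(c : ℚ_[p]) * (P * p) * hs
      · obtain ⟨h1, h2, -, h4⟩ := hnd p hpF.out hpT hpq
        have hpp := Nat.prime_iff_prime_int.1 hpF.out
        exact Padic.ternaryIsotropic_of_units hp2 (fun h => (hpp.dvd_or_dvd h).elim h1 h4)
          (fun h => (hpp.dvd_or_dvd h).elim h2 h4)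

theorem exists_ternaryIsotropic {c d e : ℤ} (hc : 0 < c) (hd : 0 < d) (he : 0 < e)
    (h : ∀ (p : ℕ) [Fact p.Prime], HasCommonValue ℚ_[p] c d e) :
    ∃ m : ℤ, 0 < m ∧ TernaryIsotropic ℚ e m ∧
      TernaryIsotropic ℚ ((c * m : ℤ) : ℚ) ((d * m : ℤ) : ℚ) := by
  have h' := fun (p : ℕ) [Fact p.Prime] => (h p).exists_integral
  choose z w n x hzw h0 using h'
  have hTz : 0 < 2 * c * d * e := by positivity
  obtain ⟨T, hTdef⟩ : ∃ T : ℕ, T = (2 * c * d * e).natAbs := ⟨_, rfl⟩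
  have hT : T ≠ 0 := by rw [hTdef, Int.natAbs_ne_zero]; exact hTz.ne'
  have hTT : (T : ℤ) = 2 * c * d * e := by rw [hTdef, Int.natCast_natAbs, abs_of_pos hTz]
  have hm : ∀ (p : ℕ) [Fact p.Prime],
      0 < ‖(c : ℚ_[p]) * (z p : ℚ_[p]) ^ 2 + d * (w p : ℚ_[p]) ^ 2‖ := fun p _ =>
    norm_pos_iff.2 (h0 p)
  have hT0 : ∀ (p : ℕ) [Fact p.Prime], 0 < ‖((T ^ 2 : ℕ) : ℚ_[p])‖ := fun p _ =>
    norm_pos_iff.2 (by exact_mod_cast pow_ne_zero 2 hT)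
  have h2 : ∀ (p : ℕ) [Fact p.Prime], 0 < ‖(2 : ℚ_[p])‖ := fun p _ => norm_pos_iff.2 two_ne_zero
  obtain ⟨K, hK⟩ := exists_int_pow_norm_lt hT
    (fun p _ => ‖((T ^ 2 : ℕ) : ℚ_[p])‖ * ‖(2 : ℚ_[p])‖ ^ 2 *
      ‖(c : ℚ_[p]) * (z p : ℚ_[p]) ^ 2 + d * (w p : ℚ_[p]) ^ 2‖)
    (fun p _ => mul_pos (mul_pos (hT0 p) (pow_pos (h2 p) 2)) (hm p))
  obtain ⟨L, hLdef⟩ : ∃ L : ℕ, L = T ^ K := ⟨_, rfl⟩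
  rw [← hLdef] at hK
  have hL : L ≠ 0 := hLdef ▸ pow_ne_zero _ hT
  have hLpos : ∀ (p : ℕ) [Fact p.Prime], 0 < ‖(L : ℚ_[p])‖ := fun p _ =>
    norm_pos_iff.2 (by exact_mod_cast hL)
  have hle : ∀ (p : ℕ) [Fact p.Prime], ‖(2 : ℚ_[p])‖ ^ 2 ≤ 1 := fun p _ =>
    pow_le_one₀ (norm_nonneg _) (by simpa using Padic.norm_int_le_one (p := p) 2)
  have hTle : ∀ (p : ℕ) [Fact p.Prime], ‖((T ^ 2 : ℕ) : ℚ_[p])‖ ≤ 1 := fun p _ => by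
    rw [← Int.cast_natCast]; exact Padic.norm_int_le_one _
  have hL2 : ∀ (p : ℕ) [Fact p.Prime], p ∣ T → ‖(L : ℚ_[p])‖ <
      ‖(2 : ℚ_[p])‖ ^ 2 * ‖(c : ℚ_[p]) * (z p : ℚ_[p]) ^ 2 + d * (w p : ℚ_[p]) ^ 2‖ :=
    fun p _ hp => (hK p hp).trans_le (by
      rw [mul_assoc]
      exact mul_le_of_le_one_left (mul_nonneg (by positivity) (norm_nonneg _)) (hTle p))
  have hL3 : ∀ (p : ℕ) [Fact p.Prime], p ∣ T → ‖(L : ℚ_[p])‖ <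
      ‖((T ^ 2 : ℕ) : ℚ_[p])‖ * ‖(c : ℚ_[p]) * (z p : ℚ_[p]) ^ 2 + d * (w p : ℚ_[p]) ^ 2‖ :=
    fun p _ hp => (hK p hp).trans_le
      (mul_le_mul_of_nonneg_right (mul_le_of_le_one_right (norm_nonneg _) (hle p)) (norm_nonneg _))
  obtain ⟨W, hW⟩ := exists_int_binary_approx T hT c d z w (fun p _ => ‖(L : ℚ_[p])‖) hLpos
  obtain ⟨Z, hZ1, hZ⟩ := hW 1
  obtain ⟨X, hX⟩ := exists_int_binary_approx T hT 1 (-e) n x (fun p _ => ‖(L : ℚ_[p])‖) hLpos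
  obtain ⟨N, hN1, hN⟩ := hX (e * X ^ 2 + 1)
  have hMpos : 0 < c * Z ^ 2 + d * W ^ 2 := by positivity
  have hM'pos : 0 < N ^ 2 - e * X ^ 2 := by
    have : 0 ≤ e * X ^ 2 := by positivity
    nlinarith
  obtain ⟨M, hM⟩ := Int.eq_ofNat_of_zero_le hMpos.le
  obtain ⟨M', hM'⟩ := Int.eq_ofNat_of_zero_le hM'pos.le
  rw [hM] at hMpos hZ
  rw [hM'] at hM'pos
  have hM0 : M ≠ 0 := by rintro rfl; simp at hMpos
  have hM'0 : M' ≠ 0 := by rintro rfl; simp at hM'pos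
  replace hN : ∀ (p : ℕ) [Fact p.Prime], p ∣ T → ‖((M' : ℤ) : ℚ_[p]) -
      (c * (z p : ℚ_[p]) ^ 2 + d * (w p : ℚ_[p]) ^ 2)‖ < ‖(L : ℚ_[p])‖ := by
    intro p _ hp
    have := hN p hp
    rw [← hM', hzw p]
    convert this using 2
    push_cast
    ring
  have hpL : ∀ p : ℕ, p.Prime → p ∣ L → p ∣ T := fun p hp h =>
    hp.dvd_of_dvd_pow (hLdef ▸ h)
  have hMM : (L : ℤ) ∣ M - M' := by
    refine Int.natCast_dvd_of_forall_padic_norm_le fun p hpF hp => ?_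
    have hpT := hpL p hpF.out hp
    have := Padic.norm_sub_le_max
      (((M : ℤ) : ℚ_[p]) - ((c : ℚ_[p]) * (z p : ℚ_[p]) ^ 2 + (d : ℚ_[p]) * (w p : ℚ_[p]) ^ 2))
      (((M' : ℤ) : ℚ_[p]) - ((c : ℚ_[p]) * (z p : ℚ_[p]) ^ 2 + (d : ℚ_[p]) * (w p : ℚ_[p]) ^ 2))
    rw [sub_sub_sub_cancel_right] at this
    rw [Int.cast_sub]
    exact this.trans (max_le (hZ p hpT).le (hN p hpT).le)
  obtain ⟨P, hPdef⟩ : ∃ P : ℕ, P = M.gcd L := ⟨_, rfl⟩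
  have hPM : P ∣ M := hPdef ▸ Nat.gcd_dvd_left _ _
  have hPL : P ∣ L := hPdef ▸ Nat.gcd_dvd_right _ _
  have hP0 : P ≠ 0 := hPdef ▸ Nat.gcd_ne_zero_right hL
  have hPT : ∀ p : ℕ, p.Prime → p ∣ P → p ∣ T := fun p hp h => hpL p hp (h.trans hPL)
  have hMnorm : ∀ (p : ℕ) [Fact p.Prime], p ∣ T →
      ‖(c : ℚ_[p]) * (z p : ℚ_[p]) ^ 2 + d * (w p : ℚ_[p]) ^ 2‖ ≤ ‖((M : ℤ) : ℚ_[p])‖ := by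
    intro p _ hp
    have h1 : ‖((M : ℤ) : ℚ_[p]) - (c * (z p : ℚ_[p]) ^ 2 + d * (w p : ℚ_[p]) ^ 2)‖ <
        ‖(c : ℚ_[p]) * (z p : ℚ_[p]) ^ 2 + d * (w p : ℚ_[p]) ^ 2‖ :=
      ((hZ p hp).trans (hL3 p hp)).trans_le (mul_le_of_le_one_left (norm_nonneg _) (hTle p))
    by_contra! hlt
    have h2 := Padic.norm_sub_le_max ((M : ℤ) : ℚ_[p])
      (((M : ℤ) : ℚ_[p]) - ((c : ℚ_[p]) * (z p : ℚ_[p]) ^ 2 + (d : ℚ_[p]) * (w p : ℚ_[p]) ^ 2))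
    rw [sub_sub_cancel] at h2
    exact absurd h2 (not_le.2 (max_lt hlt h1))
  have hPS : P * T ^ 2 ∣ L := by
    have : ((P * T ^ 2 : ℕ) : ℤ) ∣ (L : ℤ) := by
      refine Int.natCast_dvd_of_forall_padic_norm_le fun p hpF hp => ?_
      have hpT : p ∣ T := by
        rcases (hpF.out.dvd_mul).1 hp with h | h
        · exact hPT p hpF.out h
        · exact hpF.out.dvd_of_dvd_pow h
      have h1 := Padic.norm_le_norm_of_dvd (p := p) (Int.natCast_dvd_natCast.2 hPM)
      have h2 := (hMnorm p hpT).trans h1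
      rw [Nat.cast_mul, norm_mul, mul_comm, Int.cast_natCast]
      rw [Int.cast_natCast] at h2
      exact (hL3 p hpT).le.trans (mul_le_mul_of_nonneg_left h2 (norm_nonneg _))
    exact_mod_cast this
  have h4 : ∀ u : ℤ, 4 * u ∣ (2 * c * d * e) ^ 2 → 4 * u.natAbs ∣ T ^ 2 := fun u hu => by
    rw [hTdef, ← Int.natAbs_pow]
    simpa [Int.natAbs_mul] using Int.natAbs_dvd_natAbs.2 hu
  obtain ⟨q, -, hq, hqM, hJ1, hJ2⟩ := exists_prime_jacobiSym_eq_one (S := T ^ 2) (K := K)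
    hM.symm hM'.symm hM0 hM'0 hMM hL
    (h4 _ ⟨c * d * e ^ 2, by ring⟩) (h4 _ ⟨c ^ 2 * d ^ 2 * e, by ring⟩)
    (by rw [hLdef, ← pow_mul]; exact pow_dvd_pow _ (by omega)) hPdef hPS 0
  refine ⟨P * q, ?_, ternaryIsotropic_of_local hc hd he hP0 hq (hTdef ▸ hPT) hJ1 hJ2 (hTdef ▸ fun p _ hp =>
    ⟨z p, w p, n p, x p, hzw p, ?_⟩)⟩
  · have := hq.pos
    have := Nat.pos_of_ne_zero hP0
    positivity
  · refine lt_of_le_of_lt ?_ (hL2 p hp)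
    have h1 := Padic.norm_le_norm_of_dvd (p := p) hqM
    have h2 := IsUltrametricDist.norm_add_le_max
      (((P * q - M : ℤ) : ℚ_[p]))
      (((M : ℤ) : ℚ_[p]) - ((c : ℚ_[p]) * (z p : ℚ_[p]) ^ 2 + (d : ℚ_[p]) * (w p : ℚ_[p]) ^ 2))
    rw [Int.cast_sub, sub_add_sub_cancel] at h2
    rw [Int.cast_sub, Int.cast_natCast] at h1
    exact h2.trans (max_le h1 (hZ p hp).le)

theorem exists_rat_quaternary_eq_sq {a b c d : ℤ} (ha : 0 < a) (hb : 0 < b) (hc : 0 < c)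
    (hd : 0 < d) : ∃ x y z w n : ℚ, n ≠ 0 ∧ a * x ^ 2 + b * y ^ 2 + c * z ^ 2 + d * w ^ 2 = n ^ 2 := by
  obtain ⟨x, y, he, hloc⟩ := exists_int_hasCommonValue ha hb hc hd
  obtain ⟨m, hm, ⟨X, Y, N, h0, h⟩, ⟨Z, W, U, h0', h'⟩⟩ := exists_ternaryIsotropic hc hd he hloc
  have hmQ : (0 : ℚ) < m := by exact_mod_cast hm
  have heQ : (0 : ℚ) < a * x ^ 2 + b * y ^ 2 := by exact_mod_cast he
  have hcQ : (0 : ℚ) < c := by exact_mod_cast hc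
  have hdQ : (0 : ℚ) < d := by exact_mod_cast hd
  push_cast at h h'
  have hpos : ∀ s t : ℚ, 0 < s → 0 < t → ∀ u v n : ℚ, (u ≠ 0 ∨ v ≠ 0 ∨ n ≠ 0) →
      s * u ^ 2 + t * v ^ 2 = n ^ 2 → n ≠ 0 := by
    rintro s t hs ht u v n h0 h rfl
    have hu : u = 0 := by
      by_contra hu
      have := mul_pos hs (by positivity : 0 < u ^ 2)
      have : 0 ≤ t * v ^ 2 := by positivity
      linarith
    have hv : v = 0 := by
      by_contra hv
      have := mul_pos ht (by positivity : 0 < v ^ 2)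
      have : 0 ≤ s * u ^ 2 := by positivity
      linarith
    tauto
  have hN := hpos _ _ heQ hmQ X Y N h0 h
  have hU := hpos _ _ (mul_pos hcQ hmQ) (mul_pos hdQ hmQ) Z W U h0' h'
  refine ⟨x * X * (U / m), y * X * (U / m), Y * Z, Y * W, U / m * N,
    mul_ne_zero (div_ne_zero hU hmQ.ne') hN, ?_⟩
  have h2 : (c : ℚ) * Z ^ 2 + d * W ^ 2 = m * (U / m) ^ 2 := by
    field_simp
    linear_combination h'
  linear_combination (U / m) ^ 2 * h + Y ^ 2 * h2

theorem exists_int_eq_natCast_mul {ι : Type*} [Fintype ι] (v : ι → ℚ) :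
    ∃ D : ℕ, D ≠ 0 ∧ ∃ u : ι → ℤ, ∀ i, (u i : ℚ) = D * v i := by
  classical
  refine ⟨∏ i, (v i).den, Finset.prod_ne_zero_iff.2 fun i _ => (v i).den_nz,
    fun i => (∏ j ∈ univ.erase i, (v j).den : ℕ) * (v i).num, fun i => ?_⟩
  rw [← Finset.mul_prod_erase _ _ (mem_univ i)]
  push_cast
  rw [mul_comm ((v i).den : ℚ), mul_assoc, Rat.den_mul_eq_num]

/-- A positive definite rational quadratic form of rank four represents a nonzero square. -/
theorem QuadraticMap.exists_eq_sq_of_posDef (Q : QuadraticForm ℚ (Fin 4 → ℚ)) (hQ : Q.PosDef) :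
    ∃ v : Fin 4 → ℚ, ∃ n : ℚ, n ≠ 0 ∧ Q v = n ^ 2 := by
  obtain ⟨w, ⟨e⟩⟩ := Q.equivalent_weightedSumSquares
  have hfr : Module.finrank ℚ (Fin 4 → ℚ) = 4 := by simp
  generalize Module.finrank ℚ (Fin 4 → ℚ) = r at w e hfr
  subst hfr
  have hsymm : ∀ x, Q (e.symm x) = w 0 * x 0 ^ 2 + w 1 * x 1 ^ 2 + w 2 * x 2 ^ 2 + w 3 * x 3 ^ 2 := by
    intro x
    rw [QuadraticMap.IsometryEquiv.map_app, QuadraticMap.weightedSumSquares_apply, Fin.sum_univ_four]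
    simp only [smul_eq_mul]
    ring
  have hw : ∀ i, 0 < (w i).num * (w i).den := by
    intro i
    have h1 : 0 < Q (e.symm (Pi.single i 1)) := hQ _ (by
      intro h0
      have := e.symm.toLinearEquiv.map_eq_zero_iff.1 h0
      simp at this)
    have h2 : Q (e.symm (Pi.single i 1)) = w i := by
      rw [hsymm]
      fin_cases i <;> simp
    rw [h2] at h1
    exact mul_pos (Rat.num_pos.2 h1) (by exact_mod_cast (w i).den_pos)
  obtain ⟨x, y, z, t, n, hn, h⟩ := exists_rat_quaternary_eq_sq (hw 0) (hw 1) (hw 2) (hw 3)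
  refine ⟨e.symm ![(w 0).den * x, (w 1).den * y, (w 2).den * z, (w 3).den * t], n, hn, ?_⟩
  have hwi : ∀ i, (((w i).num * (w i).den : ℤ) : ℚ) = w i * (w i).den ^ 2 := fun i => by
    push_cast
    rw [← Rat.mul_den_eq_num (w i)]
    ring
  rw [hsymm, ← h, hwi, hwi, hwi, hwi]
  simp
  ring

/-- Every positive definite integral quadratic form of rank `k ≥ 4` represents the
square of some positive integer. -/
theorem stmt_0 (k : ℕ) (hk : 4 ≤ k) (a : Fin k → Fin k → ℤ) (hpos : qfPosDef a) :
    ∃ n : ℕ, 0 < n ∧ ∃ x : Fin k → ℤ, qfVal a x = (n : ℤ) ^ 2 := by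
  let Q : QuadraticForm ℚ (Fin k → ℚ) := (Matrix.toBilin'
    (Matrix.of fun i j : Fin k => if i ≤ j then (a i j : ℚ) else 0)).toQuadraticMap
  have hQ : ∀ (D : ℕ) (u : Fin k → ℤ) (v : Fin k → ℚ), (∀ i, (u i : ℚ) = D * v i) →
      (qfVal a u : ℚ) = D ^ 2 * Q v := by
    intro D u v huv
    simp only [Q, LinearMap.BilinMap.toQuadraticMap_apply, Matrix.toBilin'_apply, qfVal,
      Matrix.of_apply]
    push_cast
    simp only [huv, Finset.mul_sum]
    refine Finset.sum_congr rfl fun i _ => Finset.sum_congr rfl fun j _ => ?_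
    split_ifs <;> ring
  have hQpos : Q.PosDef := by
    intro v hv
    obtain ⟨D, hD, u, hu⟩ := exists_int_eq_natCast_mul v
    have hDQ : (D : ℚ) ≠ 0 := by exact_mod_cast hD
    have hu0 : u ≠ 0 := by
      rintro rfl
      apply hv
      funext i
      simpa [hDQ] using (hu i).symm
    have h1 : (0 : ℚ) < qfVal a u := by exact_mod_cast hpos u hu0
    rw [hQ D u v hu] at h1
    exact pos_of_mul_pos_right h1 (by positivity)
  let f : (Fin 4 → ℚ) →ₗ[ℚ] (Fin k → ℚ) := LinearMap.pi fun i =>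
    if h : i.1 < 4 then LinearMap.proj ⟨i.1, h⟩ else 0
  have hf : Function.Injective f := by
    intro x y hxy
    funext i
    have := congrFun hxy ⟨i.1, i.2.trans_le hk⟩
    simpa [f] using this
  obtain ⟨v, n, hn, hv⟩ := QuadraticMap.exists_eq_sq_of_posDef (Q.comp f) (by
    intro x hx
    exact hQpos _ ((map_ne_zero_iff f hf).2 hx))
  obtain ⟨D, hD, u, hu⟩ := exists_int_eq_natCast_mul (f v)
  have hval : (qfVal a u : ℚ) = (D * n) ^ 2 := by
    rw [hQ D u (f v) hu, mul_pow, ← hv, QuadraticMap.comp_apply]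
  have hsq : IsSquare (qfVal a u) := by
    rw [← Rat.isSquare_intCast_iff]
    exact ⟨D * n, by rw [hval, sq]⟩
  obtain ⟨s, hs⟩ := hsq
  refine ⟨s.natAbs, ?_, u, by rw [hs, Int.natAbs_sq, sq]⟩
  rw [Int.natAbs_pos]
  rintro rfl
  rw [hs] at hval
  have : (D : ℚ) * n ≠ 0 := mul_ne_zero (by exact_mod_cast hD) hn
  exact pow_ne_zero 2 this (by rw [← hval]; simp)
end

section
/- Let L be a positive definite integral binary quadratic form that is almost strongly s-regular with respect to some finite set of primes and represents at least one nonzero square. Then every positive integer m such that m² is represented by L is a multiple of m_s(L) = min{n ≥ 1 : r(n², L) ≠ 0}. -/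
open Finset

/-- The value of the binary quadratic form `a x² + b x y + c y²`. -/
def bVal (a b c x y : ℤ) : ℤ := a * x ^ 2 + b * x * y + c * y ^ 2

/-- Positive definiteness of a binary quadratic form. -/
def bPosDef (a b c : ℤ) : Prop := ∀ x y : ℤ, ¬(x = 0 ∧ y = 0) → 0 < bVal a b c x y

/-- The number of representations of `n` by the binary form `a x² + b x y + c y²`. -/
noncomputable def bRep (a b c : ℤ) (n : ℤ) : ℕ :=
  Set.ncard {v : ℤ × ℤ | bVal a b c v.1 v.2 = n}

/-- The discriminant `4ac - b²` of a binary quadratic form. -/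
def bDisc (a b c : ℤ) : ℤ := 4 * a * c - b ^ 2

/-- The local factor `h_p(d, μ) = ∑_{t=0}^{2μ} χ(p)^t` with `χ(p) = (-d | p)` for binary forms. -/
def bHp (d : ℤ) (p : ℕ) (μ : ℕ) : ℤ :=
  ∑ t ∈ Finset.range (2 * μ + 1), (jacobiSym (-d) p) ^ t

/-- Almost strong s-regularity of a binary form with respect to a finite set `P` of primes. -/
def bASSR (a b c : ℤ) (P : Finset ℕ) : Prop :=
  ∀ n₁ n₂ : ℕ, 0 < n₁ → 0 < n₂ →
    (∀ p : ℕ, p.Prime → p ∣ n₁ → p ∈ P ∨ (p : ℤ) ∣ 2 * bDisc a b c) →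
    IsCoprime (n₂ : ℤ) (2 * bDisc a b c) → (∀ p ∈ P, ¬ p ∣ n₂) →
    (bRep a b c (((n₁ : ℤ) * (n₂ : ℤ)) ^ 2) : ℤ) =
      (bRep a b c ((n₁ : ℤ) ^ 2) : ℤ) *
        ∏ p ∈ n₂.primeFactors, bHp (bDisc a b c) p (n₂.factorization p)

/-- The minimum of positive integers `n` such that `n²` is represented by the binary form. -/
noncomputable def bMs (a b c : ℤ) : ℕ :=
  sInf {n : ℕ | 0 < n ∧ bRep a b c ((n : ℤ) ^ 2) ≠ 0}

/-- A positive definite binary form has positive discriminant `4ac - b²`. -/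
theorem bPosDef.disc_pos {a b c : ℤ} (h : bPosDef a b c) : 0 < bDisc a b c := by
  have ha : 0 < a := by simpa [bVal] using h 1 0 (by simp)
  have h1 := h b (-2 * a) (by rintro ⟨-, h2⟩; omega)
  have h2 : bVal a b c b (-2 * a) = a * bDisc a b c := by unfold bVal bDisc; ring
  rw [h2] at h1
  exact pos_of_mul_pos_right h1 ha.le

/-- A positive definite binary form represents each integer only finitely often. -/
theorem bPosDef.finite_rep {a b c : ℤ} (h : bPosDef a b c) (n : ℤ) :
    {v : ℤ × ℤ | bVal a b c v.1 v.2 = n}.Finite := by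
  have hd := h.disc_pos
  refine (Set.finite_Icc ((-(4 * c * n), -(4 * a * n)) : ℤ × ℤ) (4 * c * n, 4 * a * n)).subset ?_
  rintro ⟨x, y⟩ hv
  simp only [Set.mem_ofPred_eq] at hv
  have hx : x ^ 2 ≤ 4 * c * n := by
    have : 4 * c * n = (2 * c * y + b * x) ^ 2 + bDisc a b c * x ^ 2 := by
      rw [← hv]; unfold bVal bDisc; ring
    nlinarith [sq_nonneg (2 * c * y + b * x), sq_nonneg x]
  have hy : y ^ 2 ≤ 4 * a * n := by
    have : 4 * a * n = (2 * a * x + b * y) ^ 2 + bDisc a b c * y ^ 2 := by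
      rw [← hv]; unfold bVal bDisc; ring
    nlinarith [sq_nonneg (2 * a * x + b * y), sq_nonneg y]
  have key : ∀ z B : ℤ, z ^ 2 ≤ B → -B ≤ z ∧ z ≤ B := fun z B hz =>
    ⟨by nlinarith [Int.le_self_sq (-z)], by nlinarith [Int.le_self_sq z]⟩
  exact ⟨⟨(key _ _ hx).1, (key _ _ hy).1⟩, ⟨(key _ _ hx).2, (key _ _ hy).2⟩⟩

/-- For a positive definite form, `bRep` is nonzero exactly at the represented integers. -/
theorem bPosDef.bRep_ne_zero_iff {a b c : ℤ} (h : bPosDef a b c) (n : ℤ) :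
    bRep a b c n ≠ 0 ↔ ∃ x y, bVal a b c x y = n := by
  rw [bRep, Ne, Set.ncard_eq_zero (h.finite_rep n), ← Ne, ← Set.nonempty_iff_ne_empty]
  exact ⟨fun ⟨v, hv⟩ => ⟨v.1, v.2, hv⟩, fun ⟨x, y, hv⟩ => ⟨(x, y), hv⟩⟩

/-- The least common denominator of `x / T` and `y / T`. -/
theorem exists_least_denominator {T : ℤ} (hT : T ≠ 0) (x y : ℤ) :
    ∃ N : ℕ, 0 < N ∧ T ∣ N * x ∧ T ∣ N * y ∧
      ∀ k : ℤ, T ∣ k * x → T ∣ k * y → (N : ℤ) ∣ k := by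
  set G : ℤ := gcd (gcd x y) T with hG
  have hG0 : G ≠ 0 := fun h => hT ((gcd_eq_zero_iff _ _).1 h).2
  obtain ⟨M, hM⟩ : G ∣ T := gcd_dvd_right _ _
  have hM0 : M ≠ 0 := by rintro rfl; exact hT (by simpa using hM)
  have hGx : G ∣ x := (gcd_dvd_left _ _).trans (gcd_dvd_left _ _)
  have hGy : G ∣ y := (gcd_dvd_left _ _).trans (gcd_dvd_right _ _)
  have hdvd : ∀ z, G ∣ z → T ∣ M.natAbs * z := by
    rintro z ⟨t, rfl⟩
    obtain ⟨u, hu⟩ : M ∣ (M.natAbs : ℤ) := Int.dvd_natAbs.2 dvd_rfl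
    exact ⟨u * t, by rw [hM, hu]; ring⟩
  refine ⟨M.natAbs, Int.natAbs_pos.2 hM0, hdvd x hGx, hdvd y hGy, fun k hx hy => ?_⟩
  have h2 : T ∣ k * G := by
    have h3 : T ∣ gcd (k * gcd x y) (k * T) :=
      dvd_gcd ((dvd_gcd hx hy).trans (gcd_mul_left' k x y).dvd) (dvd_mul_left _ _)
    exact h3.trans (gcd_mul_left' k _ T).dvd
  rw [hM, mul_comm] at h2
  exact Int.natAbs_dvd.2 ((mul_dvd_mul_iff_right hG0).1 h2)

/-- If `p ^ K` divides `Y` but not `X`, then `X` divides a multiple of `Y` by an integer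
prime to `p`. -/
theorem exists_not_dvd_and_dvd_mul {p K : ℕ} (hp : p.Prime) {X Y : ℤ}
    (hX : ¬ (p : ℤ) ^ K ∣ X) (hY : (p : ℤ) ^ K ∣ Y) :
    ∃ k : ℤ, ¬ (p : ℤ) ∣ k ∧ X ∣ k * Y := by
  have hX0 : X ≠ 0 := by rintro rfl; exact hX (dvd_zero _)
  have hfin : FiniteMultiplicity (p : ℤ) X :=
    Int.finiteMultiplicity_iff.2 ⟨by simpa using hp.ne_one, hX0⟩
  obtain ⟨k, hk, hpk⟩ := hfin.exists_eq_pow_mul_and_not_dvd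
  refine ⟨k, hpk, ?_⟩
  have hle : multiplicity (p : ℤ) X ≤ K := by
    by_contra! hlt
    exact hX (hk ▸ (pow_dvd_pow _ hlt.le).mul_right _)
  calc X = (p : ℤ) ^ multiplicity (p : ℤ) X * k := hk
    _ ∣ Y * k := mul_dvd_mul_right ((pow_dvd_pow _ hle).trans hY) k
    _ = k * Y := mul_comm _ _

theorem bVal_modEq {a b c n x y x' y' : ℤ} (hx : x ≡ x' [ZMOD n]) (hy : y ≡ y' [ZMOD n]) :
    bVal a b c x y ≡ bVal a b c x' y' [ZMOD n] := by
  unfold bVal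
  gcongr

/-- Simultaneous approximation: there is an integer close to `s` at the primes of `A` and
close to `t` at those of `B`. -/
theorem exists_modEq_pow_primes {A B : Finset ℕ} (hA : ∀ p ∈ A, p.Prime)
    (hB : ∀ p ∈ B, p.Prime) (hAB : Disjoint A B) (K : ℕ) (s t : ℤ) :
    ∃ d : ℤ, (∀ p ∈ A, d ≡ s [ZMOD (p : ℤ) ^ K]) ∧ ∀ p ∈ B, d ≡ t [ZMOD (p : ℤ) ^ K] := by
  have hcop : Nat.Coprime ((∏ p ∈ A, p) ^ K) ((∏ p ∈ B, p) ^ K) := by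
    refine Nat.Coprime.pow _ _ (Nat.Coprime.prod_left fun p hp => Nat.Coprime.prod_right
      fun q hq => (Nat.coprime_primes (hA p hp) (hB q hq)).2 ?_)
    rintro rfl
    exact Finset.disjoint_left.1 hAB hp hq
  obtain ⟨u, v, huv⟩ := Nat.isCoprime_iff_coprime.2 hcop
  have hdvd : ∀ (C : Finset ℕ), ∀ p ∈ C, (p : ℤ) ^ K ∣ (((∏ p ∈ C, p) ^ K : ℕ) : ℤ) := by
    intro C p hp
    exact_mod_cast pow_dvd_pow_of_dvd (Finset.dvd_prod_of_mem (fun p => p) hp) K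
  refine ⟨s + u * (((∏ p ∈ A, p) ^ K : ℕ) : ℤ) * (t - s), fun p hp => ?_, fun p hp => ?_⟩
  · refine (Int.modEq_iff_dvd.2 ?_).symm
    rw [add_sub_cancel_left]
    exact ((hdvd A p hp).mul_left u).mul_right _
  · refine Int.modEq_iff_dvd.2 ?_
    have : t - (s + u * (((∏ p ∈ A, p) ^ K : ℕ) : ℤ) * (t - s)) =
        v * (((∏ p ∈ B, p) ^ K : ℕ) : ℤ) * (t - s) := by
      linear_combination -(t - s) * huv
    rw [this]
    exact ((hdvd B p hp).mul_left v).mul_right _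

/-- If a positive definite binary form represents `m²` and `n²`, then it represents
`(gcd m n · N)²` for some `N` prime to any prescribed finite set of primes. The representation
is found by reflecting a representation of `m²` in a suitable vector. -/
theorem bPosDef.exists_rep_gcd_mul_sq {a b c : ℤ} (h : bPosDef a b c) {S : Finset ℕ}
    (hS : ∀ p ∈ S, p.Prime) (hne : S.Nonempty) {m n : ℕ} (hm : 0 < m) (hn : 0 < n)
    {x₁ y₁ x₂ y₂ : ℤ} (h₁ : bVal a b c x₁ y₁ = (m : ℤ) ^ 2)
    (h₂ : bVal a b c x₂ y₂ = (n : ℤ) ^ 2) :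
    ∃ N : ℕ, 0 < N ∧ (∀ p ∈ S, ¬ p ∣ N) ∧
      ∃ x y, bVal a b c x y = (((Nat.gcd m n : ℕ) : ℤ) * N) ^ 2 := by
  obtain ⟨g, m', n', hg, hcop, rfl, rfl⟩ :
      ∃ g m' n' : ℕ, 0 < g ∧ Nat.Coprime m' n' ∧ m = m' * g ∧ n = n' * g :=
    Nat.exists_coprime' (Nat.gcd_pos_of_pos_left n hm)
  have hgcd : Nat.gcd (m' * g) (n' * g) = g := by
    rw [Nat.gcd_mul_right, hcop.gcd_eq_one, one_mul]
  rw [hgcd]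
  have hg0 : (g : ℤ) ≠ 0 := by positivity
  have hm0 : 0 < m' := Nat.pos_of_mul_pos_right hm
  have hn0 : 0 < n' := Nat.pos_of_mul_pos_right hn
  push_cast at h₁ h₂
  set e₁ : ℤ := m' * x₂ - n' * x₁ with he₁
  set e₂ : ℤ := m' * y₂ - n' * y₁ with he₂
  by_cases hzero : e₁ = 0 ∧ e₂ = 0
  · have hc : IsCoprime (m' : ℤ) n' := Nat.isCoprime_iff_coprime.2 hcop
    obtain ⟨x, hx⟩ : (m' : ℤ) ∣ x₁ := hc.dvd_of_dvd_mul_left ⟨x₂, by linarith [hzero.1]⟩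
    obtain ⟨y, hy⟩ : (m' : ℤ) ∣ y₁ := hc.dvd_of_dvd_mul_left ⟨y₂, by linarith [hzero.2]⟩
    have hval : bVal a b c x y = (g : ℤ) ^ 2 := by
      have hm2 : (m' : ℤ) ^ 2 ≠ 0 := by positivity
      refine mul_left_cancel₀ hm2 ?_
      rw [hx, hy] at h₁
      unfold bVal at h₁ ⊢
      linear_combination h₁
    exact ⟨1, one_pos, fun p hp => (hS p hp).one_lt.ne' ∘ Nat.dvd_one.1, x, y, by simpa using hval⟩
  set f₁ : ℤ := b * x₁ + 2 * c * y₁ with hf₁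
  set f₂ : ℤ := -(2 * a * x₁ + b * y₁) with hf₂
  have hE : 0 < bVal a b c e₁ e₂ := h _ _ hzero
  have hF : 0 < bVal a b c f₁ f₂ := by
    have : bVal a b c f₁ f₂ = bDisc a b c * bVal a b c x₁ y₁ := by
      rw [hf₁, hf₂]; unfold bVal bDisc; ring
    rw [this, h₁]
    have := h.disc_pos
    positivity
  set A := S.filter fun p => ¬ p ∣ m' with hA
  set B := S.filter fun p => p ∣ m' with hB
  have hSA : ∀ p ∈ A, p.Prime := fun p hp => hS p (Finset.mem_filter.1 hp).1
  have hSB : ∀ p ∈ B, p.Prime := fun p hp => hS p (Finset.mem_filter.1 hp).1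
  have hAB : Disjoint A B := by
    rw [Finset.disjoint_left]
    exact fun p hp hp' => (Finset.mem_filter.1 hp).2 (Finset.mem_filter.1 hp').2
  set K : ℕ := (m' * bVal a b c e₁ e₂).natAbs + (m' * bVal a b c f₁ f₂).natAbs with hK
  obtain ⟨d₁, hdA₁, hdB₁⟩ := exists_modEq_pow_primes hSA hSB hAB K f₁ e₁
  obtain ⟨d₂, hdA₂, hdB₂⟩ := exists_modEq_pow_primes hSA hSB hAB K f₂ e₂
  have hsmall : ∀ p ∈ S, ∀ X : ℤ, X ≠ 0 → X.natAbs ≤ K → ¬ (p : ℤ) ^ K ∣ X := by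
    intro p hp X hX hXK hdvd
    have h1 : p ^ K ∣ X.natAbs := by
      have := Int.natAbs_dvd_natAbs.2 hdvd
      simpa [Int.natAbs_pow] using this
    have h2 := Nat.le_of_dvd (Int.natAbs_pos.2 hX) h1
    have h3 := Nat.lt_pow_self (n := K) (hS p hp).one_lt
    omega
  set F : ℤ := bVal a b c d₁ d₂ with hFd
  have hndvd : ∀ p ∈ S, ¬ (p : ℤ) ^ K ∣ m' * F := by
    intro p hp hdvd
    by_cases hpm : p ∣ m'
    · have hpB : p ∈ B := Finset.mem_filter.2 ⟨hp, hpm⟩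
      have hmod := (bVal_modEq (a := a) (b := b) (c := c) (hdB₁ p hpB) (hdB₂ p hpB)).mul_left m'
      exact hsmall p hp (m' * bVal a b c e₁ e₂) (by positivity) (Nat.le_add_right _ _)
        (hmod.dvd_iff.1 hdvd)
    · have hpA : p ∈ A := Finset.mem_filter.2 ⟨hp, hpm⟩
      have hmod := (bVal_modEq (a := a) (b := b) (c := c) (hdA₁ p hpA) (hdA₂ p hpA)).mul_left m'
      exact hsmall p hp (m' * bVal a b c f₁ f₂) (by positivity) (Nat.le_add_left _ _)
        (hmod.dvd_iff.1 hdvd)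
  have hF0 : F ≠ 0 := by
    obtain ⟨p, hp⟩ := hne
    intro h0
    exact hndvd p hp (by simp [h0])
  set β : ℤ := (2 * a * x₁ + b * y₁) * d₁ + (b * x₁ + 2 * c * y₁) * d₂ with hβ
  set z₁ : ℤ := F * x₁ - β * d₁ with hz₁
  set z₂ : ℤ := F * y₁ - β * d₂ with hz₂
  have hz : bVal a b c z₁ z₂ = (F * (m' * g)) ^ 2 := by
    rw [mul_pow, ← h₁, hz₁, hz₂, hβ, hFd]
    unfold bVal
    ring
  have hT : F * m' ≠ 0 := by positivity
  obtain ⟨N, hN0, hNx, hNy, hN⟩ := exists_least_denominator hT z₁ z₂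
  refine ⟨N, hN0, fun p hp hpN => ?_, ?_⟩
  · have hpp : Prime (p : ℤ) := Nat.prime_iff_prime_int.1 (hS p hp)
    have hpN' : (p : ℤ) ∣ N := by exact_mod_cast hpN
    by_cases hpm : p ∣ m'
    · have hpB : p ∈ B := Finset.mem_filter.2 ⟨hp, hpm⟩
      have hpn : ¬ (p : ℤ) ∣ n' := fun hd =>
        Nat.not_coprime_of_dvd_of_dvd (hS p hp).one_lt hpm (by exact_mod_cast hd) hcop
      have hY : ∀ d e : ℤ, d ≡ e [ZMOD (p : ℤ) ^ K] →
          (p : ℤ) ^ K ∣ F * e + n' * β * d := by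
        intro d e hde
        have h1 : F ≡ bVal a b c e₁ e₂ [ZMOD (p : ℤ) ^ K] :=
          bVal_modEq (hdB₁ p hpB) (hdB₂ p hpB)
        have h2 : β ≡ (2 * a * x₁ + b * y₁) * e₁ + (b * x₁ + 2 * c * y₁) * e₂
            [ZMOD (p : ℤ) ^ K] :=
          ((hdB₁ p hpB).mul_left _).add ((hdB₂ p hpB).mul_left _)
        have h3 := (h1.mul_right e).add ((h2.mul_left n').mul hde)
        have h4 : bVal a b c e₁ e₂ * e +
            n' * ((2 * a * x₁ + b * y₁) * e₁ + (b * x₁ + 2 * c * y₁) * e₂) * e = 0 := by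
          have h5 : bVal a b c e₁ e₂ +
              n' * ((2 * a * x₁ + b * y₁) * e₁ + (b * x₁ + 2 * c * y₁) * e₂) =
              m' ^ 2 * bVal a b c x₂ y₂ - n' ^ 2 * bVal a b c x₁ y₁ := by
            rw [he₁, he₂]; unfold bVal; ring
          rw [h₁, h₂] at h5
          linear_combination e * h5
        rw [h4] at h3
        exact Int.modEq_zero_iff_dvd.1 h3
      obtain ⟨k, hk, hk'⟩ := exists_not_dvd_and_dvd_mul (hS p hp) (hndvd p hp)
        (hY d₁ e₁ (hdB₁ p hpB))
      obtain ⟨l, hl, hl'⟩ := exists_not_dvd_and_dvd_mul (hS p hp) (hndvd p hp)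
        (hY d₂ e₂ (hdB₂ p hpB))
      have hfin : (N : ℤ) ∣ k * l * n' := by
        refine hN _ ?_ ?_
        · have : k * l * n' * z₁ = F * m' * (k * l * x₂) - l * (k * (F * e₁ + n' * β * d₁)) := by
            rw [hz₁, he₁]; ring
          rw [this]
          exact dvd_sub (dvd_mul_right _ _) ((mul_comm F (m' : ℤ) ▸ hk').mul_left l)
        · have : k * l * n' * z₂ = F * m' * (k * l * y₂) - k * (l * (F * e₂ + n' * β * d₂)) := by
            rw [hz₂, he₂]; ring
          rw [this]
          exact dvd_sub (dvd_mul_right _ _) ((mul_comm F (m' : ℤ) ▸ hl').mul_left k)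
      rcases hpp.dvd_or_dvd (hpN'.trans hfin) with h' | h'
      · rcases hpp.dvd_or_dvd h' with h' | h'
        exacts [hk h', hl h']
      · exact hpn h'
    · have hpA : p ∈ A := Finset.mem_filter.2 ⟨hp, hpm⟩
      have hβ0 : (p : ℤ) ^ K ∣ β := by
        have h2 : β ≡ (2 * a * x₁ + b * y₁) * f₁ + (b * x₁ + 2 * c * y₁) * f₂
            [ZMOD (p : ℤ) ^ K] :=
          ((hdA₁ p hpA).mul_left _).add ((hdA₂ p hpA).mul_left _)
        have h4 : (2 * a * x₁ + b * y₁) * f₁ + (b * x₁ + 2 * c * y₁) * f₂ = 0 := by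
          rw [hf₁, hf₂]; ring
        rw [h4] at h2
        exact Int.modEq_zero_iff_dvd.1 h2
      obtain ⟨k, hk, t, ht⟩ := exists_not_dvd_and_dvd_mul (hS p hp) (hndvd p hp) hβ0
      have hfin : (N : ℤ) ∣ k * m' :=
        hN _ ⟨k * x₁ - t * m' * d₁, by rw [hz₁]; linear_combination -m' * d₁ * ht⟩
          ⟨k * y₁ - t * m' * d₂, by rw [hz₂]; linear_combination -m' * d₂ * ht⟩
      rcases hpp.dvd_or_dvd (hpN'.trans hfin) with h' | h'
      · exact hk h'
      · exact hpm (by exact_mod_cast h')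
  · obtain ⟨x, hx⟩ := hNx
    obtain ⟨y, hy⟩ := hNy
    refine ⟨x, y, mul_left_cancel₀ (pow_ne_zero 2 hT) ?_⟩
    have h1 : bVal a b c (N * z₁) (N * z₂) = N ^ 2 * bVal a b c z₁ z₂ := by unfold bVal; ring
    have h2 : bVal a b c (F * m' * x) (F * m' * y) = (F * m') ^ 2 * bVal a b c x y := by
      unfold bVal; ring
    rw [← h2, ← hx, ← hy, h1, hz]
    ring

/-- A positive integer is the product of a part whose primes satisfy `Q` and a part none of
whose primes does. -/
theorem exists_mul_eq_primes_split (Q : ℕ → Prop) {n : ℕ} (hn : n ≠ 0) :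
    ∃ n₁ n₂ : ℕ, n = n₁ * n₂ ∧ (∀ p, p.Prime → p ∣ n₁ → Q p) ∧
      ∀ p, p.Prime → p ∣ n₂ → ¬ Q p := by
  induction n using Nat.recOnMul with
  | zero => exact absurd rfl hn
  | one => exact ⟨1, 1, rfl, fun p hp h => absurd h hp.not_dvd_one,
      fun p hp h => absurd h hp.not_dvd_one⟩
  | prime q hq =>
    by_cases hQ : Q q
    · exact ⟨q, 1, (mul_one q).symm, fun p hp h => (Nat.prime_dvd_prime_iff_eq hp hq).1 h ▸ hQ,
        fun p hp h => absurd h hp.not_dvd_one⟩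
    · exact ⟨1, q, (one_mul q).symm, fun p hp h => absurd h hp.not_dvd_one,
        fun p hp h => (Nat.prime_dvd_prime_iff_eq hp hq).1 h ▸ hQ⟩
  | mul k l hk hl =>
    obtain ⟨k₁, k₂, rfl, hk₁, hk₂⟩ := hk (left_ne_zero_of_mul hn)
    obtain ⟨l₁, l₂, rfl, hl₁, hl₂⟩ := hl (right_ne_zero_of_mul hn)
    exact ⟨k₁ * l₁, k₂ * l₂, mul_mul_mul_comm _ _ _ _,
      fun p hp h => (hp.dvd_mul.1 h).elim (hk₁ p hp) (hl₁ p hp),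
      fun p hp h => (hp.dvd_mul.1 h).elim (hk₂ p hp) (hl₂ p hp)⟩

/-- For an almost strongly s-regular positive definite binary form representing a
nonzero square, every positive integer `m` with `m²` represented is a multiple of
`m_s(L)`. -/
theorem stmt_3 (a b c : ℤ) (hpos : bPosDef a b c)
    (hreg : ∃ P : Finset ℕ, (∀ p ∈ P, p.Prime) ∧ bASSR a b c P)
    (hsq : ∃ n : ℕ, 0 < n ∧ bRep a b c ((n : ℤ) ^ 2) ≠ 0)
    (m : ℕ) (hm : 0 < m) (hrep : bRep a b c ((m : ℤ) ^ 2) ≠ 0) :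
    bMs a b c ∣ m := by
  obtain ⟨P, hP, hreg⟩ := hreg
  obtain ⟨hs, hsrep⟩ : bMs a b c ∈ {n : ℕ | 0 < n ∧ bRep a b c ((n : ℤ) ^ 2) ≠ 0} :=
    Nat.sInf_mem hsq
  have hmin : ∀ n : ℕ, 0 < n → bRep a b c ((n : ℤ) ^ 2) ≠ 0 → bMs a b c ≤ n :=
    fun n h0 hn => Nat.sInf_le ⟨h0, hn⟩
  set s := bMs a b c with hsdef
  obtain ⟨x₁, y₁, h₁⟩ := (hpos.bRep_ne_zero_iff _).1 hsrep
  obtain ⟨x₂, y₂, h₂⟩ := (hpos.bRep_ne_zero_iff _).1 hrep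
  have hd : 2 * bDisc a b c ≠ 0 := mul_ne_zero two_ne_zero hpos.disc_pos.ne'
  have hbad : ∀ p : ℕ, p ∈ P ∪ (2 * bDisc a b c).natAbs.primeFactors ↔
      p ∈ P ∨ (p.Prime ∧ (p : ℤ) ∣ 2 * bDisc a b c) := by
    intro p
    simp only [Finset.mem_union, Nat.mem_primeFactors, Int.natCast_dvd]
    have := Int.natAbs_ne_zero.2 hd
    tauto
  obtain ⟨N, hN0, hN, x, y, hxy⟩ := hpos.exists_rep_gcd_mul_sq
    (S := P ∪ (2 * bDisc a b c).natAbs.primeFactors)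
    (fun p hp => ((hbad p).1 hp).elim (hP p) And.left)
    ⟨2, (hbad 2).2 (Or.inr ⟨Nat.prime_two, dvd_mul_right _ _⟩)⟩ hs hm h₁ h₂
  have hg0 : 0 < Nat.gcd s m := Nat.gcd_pos_of_pos_left _ hs
  obtain ⟨n₁, n₂, hn, hn₁, hn₂⟩ := exists_mul_eq_primes_split
    (fun p => p ∈ P ∪ (2 * bDisc a b c).natAbs.primeFactors) (Nat.mul_pos hg0 hN0).ne'
  have hn0 : n₁ * n₂ ≠ 0 := hn ▸ (Nat.mul_pos hg0 hN0).ne'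
  have hpos₁ : 0 < n₁ := Nat.pos_of_ne_zero (left_ne_zero_of_mul hn0)
  have hpos₂ : 0 < n₂ := Nat.pos_of_ne_zero (right_ne_zero_of_mul hn0)
  have hcop : IsCoprime (n₂ : ℤ) (2 * bDisc a b c) := by
    rw [Int.isCoprime_iff_nat_coprime, Int.natAbs_natCast]
    exact Nat.coprime_of_dvd fun p hp h1 h2 =>
      hn₂ p hp h1 ((hbad p).2 (Or.inr ⟨hp, Int.natCast_dvd.2 h2⟩))
  have hfact := hreg n₁ n₂ hpos₁ hpos₂
    (fun p hp h => ((hbad p).1 (hn₁ p hp h)).imp_right And.right) hcop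
    (fun p hp h => hn₂ p (hP p hp) h ((hbad p).2 (Or.inl hp)))
  have hne : bRep a b c (((n₁ : ℤ) * (n₂ : ℤ)) ^ 2) ≠ 0 :=
    (hpos.bRep_ne_zero_iff _).2 ⟨x, y, by rw [hxy]; exact_mod_cast congrArg (· ^ 2) hn⟩
  have hne₁ : bRep a b c ((n₁ : ℤ) ^ 2) ≠ 0 := by
    intro h0
    rw [h0, Nat.cast_zero, zero_mul] at hfact
    exact hne (by exact_mod_cast hfact)
  have hcop₁ : Nat.Coprime n₁ N := Nat.coprime_of_dvd fun p hp h1 h2 => hN p (hn₁ p hp h1) h2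
  have hdvd : n₁ ∣ Nat.gcd s m := hcop₁.dvd_of_dvd_mul_right (hn ▸ dvd_mul_right n₁ n₂)
  have heq : n₁ = s := le_antisymm
    (Nat.le_of_dvd hs (hdvd.trans (Nat.gcd_dvd_left _ _))) (hmin n₁ hpos₁ hne₁)
  exact heq ▸ hdvd.trans (Nat.gcd_dvd_right _ _)
end

section
/- Let L be a positive definite integral binary quadratic form and let p be a prime dividing the discriminant dL. Then for every positive integer n, r(pn, L) = r(pn, Λ_p(L)); equivalently, every x ∈ ℤ² with L(x) = pn lies in the sublattice Λ_p(L). -/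
open Finset

/-- Membership in the Watson sublattice `Λ_p(L) = {v : L(v + z) ≡ L(z) (mod p) ∀ z}`. -/
def memLambda (q : ℕ) (a b c : ℤ) (v : ℤ × ℤ) : Prop :=
  ∀ z : ℤ × ℤ, (q : ℤ) ∣ (bVal a b c (v.1 + z.1) (v.2 + z.2) - bVal a b c z.1 z.2)

/-- If a prime `p` divides both the discriminant of a binary form and its value at `v`, then `v`
lies in the Watson sublattice `Λ_p`. -/
theorem memLambda_of_dvd {a b c : ℤ} {p : ℕ} (hprime : p.Prime) (hdvd : (p : ℤ) ∣ bDisc a b c)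
    {v : ℤ × ℤ} (hv : (p : ℤ) ∣ bVal a b c v.1 v.2) : memLambda p a b c v := by
  have hp : Prime (p : ℤ) := Nat.prime_iff_prime_int.mp hprime
  obtain ⟨x, y⟩ := v
  have h₁ : (p : ℤ) ∣ 2 * a * x + b * y := by
    refine hp.dvd_of_dvd_pow (n := 2) ?_
    have h : (2 * a * x + b * y) ^ 2 = 4 * a * bVal a b c x y - y ^ 2 * bDisc a b c := by
      unfold bVal bDisc
      ring
    rw [h]
    exact dvd_sub (hv.mul_left _) (hdvd.mul_left _)
  have h₂ : (p : ℤ) ∣ b * x + 2 * c * y := by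
    refine hp.dvd_of_dvd_pow (n := 2) ?_
    have h : (b * x + 2 * c * y) ^ 2 = 4 * c * bVal a b c x y - x ^ 2 * bDisc a b c := by
      unfold bVal bDisc
      ring
    rw [h]
    exact dvd_sub (hv.mul_left _) (hdvd.mul_left _)
  rintro ⟨z, w⟩
  have h : bVal a b c (x + z) (y + w) - bVal a b c z w =
      bVal a b c x y + (2 * a * x + b * y) * z + (b * x + 2 * c * y) * w := by
    unfold bVal
    ring
  rw [h]
  exact dvd_add (dvd_add hv (h₁.mul_right _)) (h₂.mul_right _)

/-- If `p` divides the discriminant of a positive definite binary form `L`, then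
`r(pn, L) = r(pn, Λ_p(L))` for every positive integer `n`. -/
theorem stmt_4 (a b c : ℤ) (hpos : bPosDef a b c) (p : ℕ) (hprime : p.Prime)
    (hdvd : (p : ℤ) ∣ bDisc a b c) (n : ℕ) (hn : 0 < n) :
    bRep a b c ((p : ℤ) * n) =
      Set.ncard {v : ℤ × ℤ |
        memLambda p a b c v ∧ bVal a b c v.1 v.2 = (p : ℤ) * n} := by
  unfold bRep
  congr 1
  ext v
  exact ⟨fun hv => ⟨memLambda_of_dvd hprime hdvd ⟨n, hv⟩, hv⟩, And.right⟩
end
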